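/- For every integer n ≥ 4 that is a multiple of 4, there exists a set P of n points in ℝ² in general position that has exactly 2^{n−3} order-1 Delaunay triangulations. -/

import Mathlib

open EuclideanGeometry Set

noncomputable section

/-- Points of the Euclidean plane. -/
abbrev Pt : Type := EuclideanSpace ℝ (Fin 2)

noncomputable instance : DecidableEq Pt := Classical.decEq _

/-- `P` is in general position: no three (distinct) points collinear and
no four (distinct) points concyclic. -/
def GenPos (P : Set Pt) : Prop :=
  (∀ u v w : Pt, u ∈ P → v ∈ P → w ∈ P → u ≠ v → u ≠ w → v ≠ w →
    ¬ Collinear ℝ ({u, v, w} : Set Pt)) ∧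
  (∀ u v w z : Pt, u ∈ P → v ∈ P → w ∈ P → z ∈ P →
    u ≠ v → u ≠ w → u ≠ z → v ≠ w → v ≠ z → w ≠ z →
    ¬ EuclideanGeometry.Cospherical ({u, v, w, z} : Set Pt))

/-- The (closed) triangle spanned by a finite set of points. -/
def triSet (t : Finset Pt) : Set Pt := convexHull ℝ (t : Set Pt)

/-- `T` is a triangulation of `P`: a finite set of triangles with vertices in `P`,
every point of `P` is a vertex of some triangle, the interiors of the triangles are
pairwise disjoint, and their union is the convex hull of `P`. -/
def IsTriangulation (P : Set Pt) (T : Set (Finset Pt)) : Prop :=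
  T.Finite ∧
  (∀ t ∈ T, t.card = 3 ∧ (t : Set Pt) ⊆ P) ∧
  (∀ p ∈ P, ∃ t ∈ T, p ∈ t) ∧
  (T.Pairwise fun t s => interior (triSet t) ∩ interior (triSet s) = ∅) ∧
  (⋃ t ∈ T, triSet t) = convexHull ℝ P

/-- The triangle `t` (with vertex set `t`) is order-`k` Delaunay with respect to `P`:
the open disk bounded by its circumcircle contains at most `k` points of `P`. -/
def OrderKTri (P : Set Pt) (k : ℕ) (t : Finset Pt) : Prop :=
  ∃ z : Pt, ∃ r : ℝ, (∀ p ∈ t, dist p z = r) ∧ {p ∈ P | dist p z < r}.encard ≤ (k : ℕ∞)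

/-- `T` is an order-`k` Delaunay triangulation of `P`. -/
def IsOrderDT (P : Set Pt) (k : ℕ) (T : Set (Finset Pt)) : Prop :=
  IsTriangulation P T ∧ ∀ t ∈ T, OrderKTri P k t

/-- `{u, v}` is an order-`k` Delaunay edge of `P`: some open disk having `u` and `v`
on its boundary circle contains at most `k` points of `P`. -/
def OrderKEdge (P : Set Pt) (k : ℕ) (u v : Pt) : Prop :=
  ∃ z : Pt, ∃ r : ℝ, dist u z = r ∧ dist v z = r ∧ {p ∈ P | dist p z < r}.encard ≤ (k : ℕ∞)

/-- `{u, v}` is a useful order-`k` Delaunay edge of `P`: some order-`k` Delaunay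
triangulation of `P` contains a triangle having `u` and `v` among its vertices
(i.e. having segment `uv` as a side). -/
def UsefulEdge (P : Set Pt) (k : ℕ) (u v : Pt) : Prop :=
  ∃ T, IsOrderDT P k T ∧ ∃ t ∈ T, u ∈ t ∧ v ∈ t

/-- `{u, v}` is a Delaunay edge: it is an edge of the (unique) order-0 Delaunay
triangulation of `P`. -/
def DelaunayEdge (P : Set Pt) (u v : Pt) : Prop := UsefulEdge P 0 u v

/-- `p` lies strictly to the left of the directed line from `v` to `u`, i.e. the
triple `v, u, p` makes a counterclockwise turn. -/
def ccw (v u p : Pt) : Prop :=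
  0 < (u 0 - v 0) * (p 1 - v 1) - (u 1 - v 1) * (p 0 - v 0)

/-! ### Orientation and in-circle determinants -/

/-- Twice the signed area of the triangle `abc`. -/
def orient (a b c : Pt) : ℝ := (b 0 - a 0) * (c 1 - a 1) - (b 1 - a 1) * (c 0 - a 0)

/-- The in-circle determinant: for `abc` counterclockwise it is positive exactly when `d` lies
outside the circumcircle of `abc`. -/
def circleDet (a b c d : Pt) : ℝ :=
  orient a b c * (d 0 ^ 2 + d 1 ^ 2) - orient a b d * (c 0 ^ 2 + c 1 ^ 2) +
    orient a c d * (b 0 ^ 2 + b 1 ^ 2) - orient b c d * (a 0 ^ 2 + a 1 ^ 2)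

/-- The power of `w` with respect to the circle with centre `z` and radius `r`. -/
def power (z : Pt) (r : ℝ) (w : Pt) : ℝ := (w 0 - z 0) ^ 2 + (w 1 - z 1) ^ 2 - r ^ 2

theorem orient_rotate (a b c : Pt) : orient b c a = orient a b c := by
  simp only [orient]; ring

theorem orient_swap (a b c : Pt) : orient b a c = -orient a b c := by
  simp only [orient]; ring

theorem orient_swap_right (a b c : Pt) : orient a c b = -orient a b c := by
  simp only [orient]; ring

theorem orient_self_left (a b : Pt) : orient a b a = 0 := by simp only [orient]; ring

theorem orient_self_right (a b : Pt) : orient a b b = 0 := by simp only [orient]; ring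

theorem orient_self (a b : Pt) : orient a a b = 0 := by simp only [orient]; ring

theorem orient_add_orient_add_orient (a b c x : Pt) :
    orient b c x + orient c a x + orient a b x = orient a b c := by
  simp only [orient]; ring

/-- Barycentric expansion of `orient u v x` in the triangle `abc`. -/
theorem orient_barycentric (a b c u v x : Pt) :
    orient a b c * orient u v x =
      orient b c x * orient u v a + orient c a x * orient u v b + orient a b x * orient u v c := by
  simp only [orient]; ring

theorem circleDet_rotate (a b c d : Pt) : circleDet b c a d = circleDet a b c d := by
  simp only [circleDet, orient]; ring

theorem circleDet_swap_right (a b c d : Pt) : circleDet a b d c = -circleDet a b c d := by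
  simp only [circleDet, orient]; ring

theorem circleDet_eq_power (z : Pt) (r : ℝ) (a b c d : Pt) :
    circleDet a b c d = orient a b c * power z r d - orient a b d * power z r c +
      orient a c d * power z r b - orient b c d * power z r a := by
  simp only [circleDet, orient, power]; ring

theorem orient_mul_circleDet (u v c a b : Pt) :
    orient u v c * circleDet u v a b =
      orient u v a * circleDet u v c b - orient u v b * circleDet u v c a := by
  simp only [circleDet, orient]; ring

/-- A point inside a triangle is inside its circumcircle. -/
theorem circleDet_mul_orient (a b c d : Pt) :
    circleDet a b c d * orient a b c =
      -(orient b c d * orient c a d * ((a 0 - b 0) ^ 2 + (a 1 - b 1) ^ 2) +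
        orient c a d * orient a b d * ((b 0 - c 0) ^ 2 + (b 1 - c 1) ^ 2) +
        orient a b d * orient b c d * ((c 0 - a 0) ^ 2 + (c 1 - a 1) ^ 2)) := by
  simp only [circleDet, orient]; ring

theorem power_eq_dist (z : Pt) (r : ℝ) (w : Pt) : power z r w = dist w z ^ 2 - r ^ 2 := by
  rw [EuclideanSpace.dist_eq, Real.sq_sqrt (by positivity)]
  simp [power, Fin.sum_univ_two, Real.dist_eq, sq_abs]

theorem power_eq_zero {z w : Pt} {r : ℝ} (h : dist w z = r) : power z r w = 0 := by
  rw [power_eq_dist, h, sub_self]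

theorem power_neg_iff {z w : Pt} {r : ℝ} (hr : 0 ≤ r) : power z r w < 0 ↔ dist w z < r := by
  rw [power_eq_dist, sub_neg, sq_lt_sq₀ dist_nonneg hr]

theorem exists_circumcircle {a b c : Pt} (h : orient a b c ≠ 0) :
    ∃ z r, dist a z = r ∧ dist b z = r ∧ dist c z = r := by
  set z : Pt := !₂[a 0 + ((c 1 - a 1) * ((b 0 - a 0) ^ 2 + (b 1 - a 1) ^ 2) -
      (b 1 - a 1) * ((c 0 - a 0) ^ 2 + (c 1 - a 1) ^ 2)) / (2 * orient a b c),
    a 1 + ((b 0 - a 0) * ((c 0 - a 0) ^ 2 + (c 1 - a 1) ^ 2) -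
      (c 0 - a 0) * ((b 0 - a 0) ^ 2 + (b 1 - a 1) ^ 2)) / (2 * orient a b c)] with hz
  refine ⟨z, dist a z, rfl, ?_, ?_⟩ <;>
  · rw [EuclideanSpace.dist_eq, EuclideanSpace.dist_eq]
    congr 1
    simp only [Fin.sum_univ_two, Real.dist_eq, sq_abs, hz, Matrix.cons_val_zero,
      Matrix.cons_val_one, Matrix.cons_val_fin_one]
    field_simp
    simp only [orient]
    ring

/-- An order-1 Delaunay triangle has a circle with at most one point of `P` inside. -/
theorem OrderKTri.exists_power {P : Set Pt} {t : Finset Pt} (h : OrderKTri P 1 t)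
    (ht : t.Nonempty) :
    ∃ z r, (∀ p ∈ t, power z r p = 0) ∧ {w ∈ P | power z r w < 0}.Subsingleton := by
  obtain ⟨z, r, h1, h2⟩ := h
  obtain ⟨p, hp⟩ := ht
  have hr : 0 ≤ r := h1 p hp ▸ dist_nonneg
  refine ⟨z, r, fun p hp => power_eq_zero (h1 p hp), ?_⟩
  simp only [power_neg_iff hr]
  exact Set.encard_le_one_iff_subsingleton.1 (by simpa using h2)

/-! ### Triangles -/

theorem mem_triSet {a b c x : Pt} : x ∈ triSet {a, b, c} ↔
    ∃ α β γ : ℝ, 0 ≤ α ∧ 0 ≤ β ∧ 0 ≤ γ ∧ α + β + γ = 1 ∧ x = α • a + β • b + γ • c := by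
  constructor
  · intro h
    simp only [triSet, Finset.coe_insert, Finset.coe_singleton] at h
    rw [convexHull_insert (by simp), convexHull_pair, mem_convexJoin] at h
    obtain ⟨_, rfl, y, ⟨β, γ, hβ, hγ, hs, rfl⟩, ⟨α, δ, hα, hδ, hs', rfl⟩⟩ := h
    refine ⟨α, δ * β, δ * γ, hα, by positivity, by positivity, ?_, ?_⟩
    · rw [add_assoc, ← mul_add, hs, mul_one, hs']
    · rw [smul_add, smul_smul, smul_smul, add_assoc]
  · rintro ⟨α, β, γ, hα, hβ, hγ, hs, rfl⟩
    have hc := convex_convexHull ℝ ((({a, b, c} : Finset Pt)) : Set Pt)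
    have := hc.sum_mem (t := Finset.univ) (w := ![α, β, γ]) (z := ![a, b, c])
      (by intro i _; fin_cases i <;> simpa) (by simpa [Fin.sum_univ_three] using hs)
      (by intro i _; fin_cases i <;> exact subset_convexHull ℝ _ (by simp))
    simpa [Fin.sum_univ_three, triSet] using this

theorem affine_combination (p q r : ℝ) {a b c : Pt} {α β γ : ℝ} (hs : α + β + γ = 1) :
    p * (α • a + β • b + γ • c) 0 + q * (α • a + β • b + γ • c) 1 + r =
      α * (p * a 0 + q * a 1 + r) + β * (p * b 0 + q * b 1 + r) +
        γ * (p * c 0 + q * c 1 + r) := by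
  simp only [PiLp.add_apply, PiLp.smul_apply, smul_eq_mul]
  linear_combination (-r) * hs

theorem orient_affine_combination (u v : Pt) {a b c : Pt} {α β γ : ℝ} (hs : α + β + γ = 1) :
    orient u v (α • a + β • b + γ • c) =
      α * orient u v a + β * orient u v b + γ * orient u v c := by
  have h := affine_combination (-(v 1 - u 1)) (v 0 - u 0)
    ((v 1 - u 1) * u 0 - (v 0 - u 0) * u 1) hs (a := a) (b := b) (c := c)
  simp only [orient]
  linear_combination h

theorem mem_triSet_of_orient {a b c x : Pt} (h : 0 < orient a b c) (ha : 0 ≤ orient b c x)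
    (hb : 0 ≤ orient c a x) (hc : 0 ≤ orient a b x) : x ∈ triSet {a, b, c} := by
  refine mem_triSet.2 ⟨orient b c x / orient a b c, orient c a x / orient a b c,
    orient a b x / orient a b c, by positivity, by positivity, by positivity, ?_, ?_⟩
  · rw [← add_div, ← add_div, orient_add_orient_add_orient, div_self h.ne']
  · ext i
    simp only [PiLp.add_apply, PiLp.smul_apply, smul_eq_mul]
    field_simp
    fin_cases i <;> simp only [orient, Fin.zero_eta, Fin.mk_one] <;> ring

theorem continuous_orient (a b : Pt) : Continuous (orient a b) := by
  unfold orient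
  fun_prop

theorem interior_triSet_nonempty {a b c : Pt} (h : orient a b c ≠ 0) :
    (interior (triSet {a, b, c})).Nonempty := by
  wlog hpos : 0 < orient a b c generalizing a b
  · have := this (a := b) (b := a) (by rwa [orient_swap, neg_ne_zero])
      (by rw [orient_swap]; have := lt_of_le_of_ne (not_lt.1 hpos) h; linarith)
    rwa [Finset.insert_comm] at this
  set x : Pt := (1 / 3 : ℝ) • a + (1 / 3 : ℝ) • b + (1 / 3 : ℝ) • c with hx
  have hb : ∀ u v, orient u v x = 1 / 3 * orient u v a + 1 / 3 * orient u v b +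
      1 / 3 * orient u v c := fun u v => orient_affine_combination u v (by norm_num)
  refine ⟨x, mem_interior.2 ⟨{y | 0 < orient b c y} ∩ {y | 0 < orient c a y} ∩
    {y | 0 < orient a b y}, ?_, ?_, ?_⟩⟩
  · rintro y ⟨⟨h1, h2⟩, h3⟩
    exact mem_triSet_of_orient hpos (le_of_lt h1) (le_of_lt h2) (le_of_lt h3)
  · have ho : ∀ u v : Pt, IsOpen {y | 0 < orient u v y} := fun u v =>
      isOpen_lt continuous_const (continuous_orient u v)
    exact ((ho _ _).inter (ho _ _)).inter (ho _ _)
  · simp only [mem_inter_iff, mem_ofPred_eq, hb, orient_self_left, orient_self_right]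
    rw [orient_rotate a b c, orient_rotate b c a, orient_rotate a b c]
    refine ⟨⟨?_, ?_⟩, ?_⟩ <;> linarith

theorem isClosed_triSet (t : Finset Pt) : IsClosed (triSet t) :=
  t.finite_toSet.isClosed_convexHull ℝ

theorem mem_triSet_of_mem {t : Finset Pt} {p : Pt} (h : p ∈ t) : p ∈ triSet t :=
  subset_convexHull ℝ _ h

/-- Triangles with disjoint interiors are separated by a line. -/
theorem exists_separating_line {t s : Finset Pt} (ht : (interior (triSet t)).Nonempty)
    (hs : (interior (triSet s)).Nonempty)
    (h : interior (triSet t) ∩ interior (triSet s) = ∅) :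
    ∃ α β γ : ℝ, (α ≠ 0 ∨ β ≠ 0) ∧ (∀ x ∈ triSet t, α * x 0 + β * x 1 + γ ≤ 0) ∧
      ∀ x ∈ triSet s, 0 ≤ α * x 0 + β * x 1 + γ := by
  have hct : Convex ℝ (triSet t) := convex_convexHull ℝ _
  have hcs : Convex ℝ (triSet s) := convex_convexHull ℝ _
  obtain ⟨f, u, h1, h2⟩ := geometric_hahn_banach_open hct.interior isOpen_interior
    hcs.interior (Set.disjoint_iff_inter_eq_empty.2 h)
  have hf : ∀ x : Pt, f x = f !₂[1, 0] * x 0 + f !₂[0, 1] * x 1 := by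
    intro x
    have : x = x 0 • (!₂[1, 0] : Pt) + x 1 • (!₂[0, 1] : Pt) := by
      ext i; fin_cases i <;> simp
    conv_lhs => rw [this]
    simp only [map_add, map_smul, smul_eq_mul]
    ring
  have h1' : ∀ x ∈ triSet t, f x ≤ u := by
    have : closure (interior (triSet t)) ⊆ {x | f x ≤ u} :=
      closure_minimal (fun x hx => (h1 x hx).le) (isClosed_le f.continuous continuous_const)
    rw [hct.closure_interior_eq_closure_of_nonempty_interior ht] at this
    exact fun x hx => this (subset_closure hx)
  have h2' : ∀ x ∈ triSet s, u ≤ f x := by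
    have : closure (interior (triSet s)) ⊆ {x | u ≤ f x} :=
      closure_minimal (fun x hx => h2 x hx) (isClosed_le continuous_const f.continuous)
    rw [hcs.closure_interior_eq_closure_of_nonempty_interior hs] at this
    exact fun x hx => this (subset_closure hx)
  refine ⟨f !₂[1, 0], f !₂[0, 1], -u, ?_, fun x hx => ?_, fun x hx => ?_⟩
  · by_contra! h0
    obtain ⟨x, hx⟩ := ht
    obtain ⟨y, hy⟩ := hs
    have hx' := h1 x hx
    have hy' := h2 y hy
    rw [hf, h0.1, h0.2] at hx' hy'
    linarith
  · have := h1' x hx; rw [hf] at this; linarith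
  · have := h2' x hx; rw [hf] at this; linarith

/-- A nontrivial affine functional vanishes on no three noncollinear points. -/
theorem orient_eq_zero_of_affine {α β γ : ℝ} (h : α ≠ 0 ∨ β ≠ 0) {a b c : Pt}
    (ha : α * a 0 + β * a 1 + γ = 0) (hb : α * b 0 + β * b 1 + γ = 0)
    (hc : α * c 0 + β * c 1 + γ = 0) : orient a b c = 0 := by
  have h1 : α * orient a b c = 0 := by
    simp only [orient]
    linear_combination (c 1 - a 1) * (hb - ha) - (b 1 - a 1) * (hc - ha)
  have h2 : β * orient a b c = 0 := by
    simp only [orient]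
    linear_combination (b 0 - a 0) * (hc - ha) - (c 0 - a 0) * (hb - ha)
  rcases h with h | h
  · exact (mul_eq_zero.1 h1).resolve_left h
  · exact (mul_eq_zero.1 h2).resolve_left h

/-- Triangles on the same side of a common edge overlap. -/
theorem interior_inter_interior_ne_empty {a b c d : Pt} (h : 0 < orient a b c * orient a b d) :
    interior (triSet {a, b, c}) ∩ interior (triSet {a, b, d}) ≠ ∅ := by
  intro he
  have hc := left_ne_zero_of_mul h.ne'
  have hd := right_ne_zero_of_mul h.ne'
  obtain ⟨α, β, γ, h0, h1, h2⟩ := exists_separating_line (interior_triSet_nonempty hc)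
    (interior_triSet_nonempty hd) he
  have ha := le_antisymm (h1 a (mem_triSet_of_mem (by simp)))
    (h2 a (mem_triSet_of_mem (by simp)))
  have hb := le_antisymm (h1 b (mem_triSet_of_mem (by simp)))
    (h2 b (mem_triSet_of_mem (by simp)))
  have hc1 := h1 c (mem_triSet_of_mem (by simp))
  have hd1 := h2 d (mem_triSet_of_mem (by simp))
  have key : orient a b c * (α * d 0 + β * d 1 + γ) =
      orient a b d * (α * c 0 + β * c 1 + γ) := by
    have : orient a b c * (α * d 0 + β * d 1 + γ) =
      orient b c d * (α * a 0 + β * a 1 + γ) + orient c a d * (α * b 0 + β * b 1 + γ) +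
      orient a b d * (α * c 0 + β * c 1 + γ) := by simp only [orient]; ring
    rw [this, ha, hb]; ring
  have hc0 : α * c 0 + β * c 1 + γ = 0 := by
    rcases lt_or_gt_of_ne hc with hneg | hpos
    · have : orient a b d < 0 := by nlinarith
      nlinarith
    · have : 0 < orient a b d := by nlinarith
      nlinarith
  exact hc (orient_eq_zero_of_affine h0 ha hb hc0)

/-- Triangles on different sides of a line have disjoint interiors. -/
theorem interior_inter_interior_eq_empty {a b : Pt} (hab : a ≠ b) {t s : Finset Pt}
    (ht : ∀ x ∈ t, 0 ≤ orient a b x) (hs : ∀ x ∈ s, orient a b x ≤ 0) :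
    interior (triSet t) ∩ interior (triSet s) = ∅ := by
  have hcvx : Convex ℝ {x | 0 ≤ orient a b x} ∧ Convex ℝ {x | orient a b x ≤ 0} := by
    constructor <;>
    · intro x hx y hy p q hp hq hpq
      have h := orient_affine_combination a b (a := x) (b := y) (c := y) (α := p) (β := q) (γ := 0)
        (by rw [add_zero, hpq])
      rw [zero_smul, add_zero, zero_mul, add_zero] at h
      simp only [mem_ofPred_eq] at hx hy ⊢
      rw [h]
      nlinarith
  have h1 : triSet t ⊆ {x | 0 ≤ orient a b x} := convexHull_min ht hcvx.1
  have h2 : triSet s ⊆ {x | orient a b x ≤ 0} := convexHull_min hs hcvx.2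
  rw [← interior_inter, eq_empty_iff_forall_notMem]
  intro x hx
  set n : Pt := !₂[-(b 1 - a 1), b 0 - a 0] with hn
  have hcont : Filter.Tendsto (fun ε : ℝ => x + ε • n) (nhds 0) (nhds x) :=
    Continuous.tendsto' (by fun_prop) _ _ (by simp)
  have hev := hcont.eventually (mem_interior_iff_mem_nhds.1 hx)
  obtain ⟨ε, hε, hpos⟩ := ((hev.filter_mono nhdsWithin_le_nhds).and
    (self_mem_nhdsWithin (s := Ioi (0 : ℝ)))).exists
  have e1 : orient a b (x + ε • n) = 0 := le_antisymm (h2 hε.2) (h1 hε.1)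
  have e0 : orient a b x = 0 :=
    le_antisymm (h2 (interior_subset hx).2) (h1 (interior_subset hx).1)
  have key : orient a b (x + ε • n) =
      orient a b x + ε * ((b 0 - a 0) ^ 2 + (b 1 - a 1) ^ 2) := by
    simp only [orient, hn, PiLp.add_apply, PiLp.smul_apply, smul_eq_mul, Matrix.cons_val_zero,
      Matrix.cons_val_one, Matrix.cons_val_fin_one]
    ring
  rw [e1, e0, zero_add] at key
  have hz := (mul_eq_zero.1 key.symm).resolve_left (ne_of_gt hpos)
  apply hab
  ext i
  fin_cases i
  · simp only [Fin.zero_eta]; nlinarith [sq_nonneg (b 0 - a 0), sq_nonneg (b 1 - a 1)]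
  · simp only [Fin.mk_one]; nlinarith [sq_nonneg (b 0 - a 0), sq_nonneg (b 1 - a 1)]

/-! ### Triangulations of generic point sets -/

/-- Algebraic form of general position. -/
structure Generic (P : Set Pt) : Prop where
  orient_ne : ∀ {a b c : Pt}, a ∈ P → b ∈ P → c ∈ P → a ≠ b → a ≠ c → b ≠ c → orient a b c ≠ 0
  circleDet_ne : ∀ {a b c d : Pt}, a ∈ P → b ∈ P → c ∈ P → d ∈ P → a ≠ b → a ≠ c → a ≠ d →
    b ≠ c → b ≠ d → c ≠ d → circleDet a b c d ≠ 0

theorem Generic.genPos {P : Set Pt} (hP : Generic P) : GenPos P := by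
  refine ⟨fun u v w hu hv hw huv huw hvw hcol => hP.orient_ne hu hv hw huv huw hvw ?_,
    fun u v w z hu hv hw hz huv huw huz hvw hvz hwz hcos =>
      hP.circleDet_ne hu hv hw hz huv huw huz hvw hvz hwz ?_⟩
  · obtain ⟨d, hd⟩ := (collinear_iff_of_mem (p₀ := u) (by simp)).1 hcol
    obtain ⟨r, hr⟩ := hd v (by simp)
    obtain ⟨s, hs⟩ := hd w (by simp)
    rw [hr, hs]
    simp only [orient, vadd_eq_add, PiLp.add_apply, PiLp.smul_apply, smul_eq_mul]
    ring
  · obtain ⟨c, r, hc⟩ := hcos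
    have h : ∀ x ∈ ({u, v, w, z} : Set Pt), power c r x = 0 := fun x hx =>
      power_eq_zero (hc x hx)
    rw [circleDet_eq_power c r, h u (by simp), h v (by simp), h w (by simp), h z (by simp)]
    ring

theorem ne_of_card_triple {a b c : Pt} (h : ({a, b, c} : Finset Pt).card = 3) :
    a ≠ b ∧ a ≠ c ∧ b ≠ c := by
  refine ⟨?_, ?_, ?_⟩ <;> rintro rfl
  · have := Finset.card_le_two (a := a) (b := c); simp at h; omega
  · have := Finset.card_le_two (a := a) (b := b)
    rw [Finset.pair_comm b a, Finset.insert_idem] at h; omega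
  · have := Finset.card_le_two (a := a) (b := b); simp at h; omega

theorem exists_eq_triple {t : Finset Pt} (h : t.card = 3) {a b : Pt} (ha : a ∈ t) (hb : b ∈ t)
    (hab : a ≠ b) : ∃ c, t = {a, b, c} := by
  have h1 : ((t.erase a).erase b).card = 1 := by
    rw [Finset.card_erase_of_mem (Finset.mem_erase.2 ⟨hab.symm, hb⟩),
      Finset.card_erase_of_mem ha, h]
  obtain ⟨c, hc⟩ := Finset.card_eq_one.1 h1
  refine ⟨c, ?_⟩
  rw [← hc, Finset.insert_erase (Finset.mem_erase.2 ⟨hab.symm, hb⟩), Finset.insert_erase ha]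

theorem exists_eq_triple_of_mem {t : Finset Pt} (h : t.card = 3) {a : Pt} (ha : a ∈ t) :
    ∃ b c, t = {a, b, c} := by
  obtain ⟨b, hb, hab⟩ := Finset.exists_mem_ne (by omega) a (s := t)
  obtain ⟨c, hc⟩ := exists_eq_triple h ha hb hab.symm
  exact ⟨b, c, hc⟩

section

variable {P : Set Pt} {T : Set (Finset Pt)}

theorem IsTriangulation.triple (hT : IsTriangulation P T) {a b c : Pt}
    (h : {a, b, c} ∈ T) : (a ∈ P ∧ b ∈ P ∧ c ∈ P) ∧ a ≠ b ∧ a ≠ c ∧ b ≠ c := by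
  obtain ⟨h1, h2⟩ := hT.2.1 _ h
  exact ⟨⟨h2 (by simp), h2 (by simp), h2 (by simp)⟩, ne_of_card_triple h1⟩

theorem IsTriangulation.orient_ne (hT : IsTriangulation P T) (hP : Generic P) {a b c : Pt}
    (h : {a, b, c} ∈ T) : orient a b c ≠ 0 := by
  obtain ⟨⟨ha, hb, hc⟩, hab, hac, hbc⟩ := hT.triple h
  exact hP.orient_ne ha hb hc hab hac hbc

theorem IsTriangulation.interior_nonempty (hT : IsTriangulation P T) (hP : Generic P)
    {t : Finset Pt} (h : t ∈ T) : (interior (triSet t)).Nonempty := by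
  obtain ⟨a, b, c, -, -, -, rfl⟩ := Finset.card_eq_three.1 (hT.2.1 t h).1
  exact interior_triSet_nonempty (hT.orient_ne hP h)

theorem IsTriangulation.exists_separating_line (hT : IsTriangulation P T) (hP : Generic P)
    {t s : Finset Pt} (ht : t ∈ T) (hs : s ∈ T) (hne : t ≠ s) :
    ∃ α β γ : ℝ, (α ≠ 0 ∨ β ≠ 0) ∧ (∀ x ∈ triSet t, α * x 0 + β * x 1 + γ ≤ 0) ∧
      ∀ x ∈ triSet s, 0 ≤ α * x 0 + β * x 1 + γ :=
  _root_.exists_separating_line (hT.interior_nonempty hP ht) (hT.interior_nonempty hP hs)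
    (hT.2.2.2.1 ht hs hne)

/-- Triangles of a triangulation contain no further points of `P`. -/
theorem IsTriangulation.eq_of_mem_triSet (hT : IsTriangulation P T) (hP : Generic P)
    {a b c p : Pt} (ht : {a, b, c} ∈ T) (hp : p ∈ P) (h : p ∈ triSet {a, b, c}) :
    p = a ∨ p = b ∨ p = c := by
  by_contra! hne
  obtain ⟨⟨ha, hb, hc⟩, hab, hac, hbc⟩ := hT.triple ht
  obtain ⟨s, hs, hps⟩ := hT.2.2.1 p hp
  obtain ⟨α, β, γ, h0, h1, h2⟩ := hT.exists_separating_line hP ht hs (by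
    rintro rfl; simp only [Finset.mem_insert, Finset.mem_singleton] at hps; tauto)
  have hp0 := le_antisymm (h1 p h) (h2 p (mem_triSet_of_mem hps))
  obtain ⟨x, y, z, hx, hy, hz, hsum, rfl⟩ := mem_triSet.1 h
  have e1 := orient_affine_combination b c hsum (a := a) (b := b) (c := c)
  have e2 := orient_affine_combination c a hsum (a := a) (b := b) (c := c)
  have e3 := orient_affine_combination a b hsum (a := a) (b := b) (c := c)
  simp only [orient_self_left, orient_self_right, mul_zero, add_zero, zero_add] at e1 e2 e3
  have hx' : 0 < x := hx.lt_of_ne (by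
    rintro rfl; exact hP.orient_ne hb hc hp hbc hne.2.1.symm hne.2.2.symm (by rw [e1, zero_mul]))
  have hy' : 0 < y := hy.lt_of_ne (by
    rintro rfl
    exact hP.orient_ne hc ha hp hac.symm hne.2.2.symm hne.1.symm (by rw [e2, zero_mul]))
  have hz' : 0 < z := hz.lt_of_ne (by
    rintro rfl; exact hP.orient_ne ha hb hp hab hne.1.symm hne.2.1.symm (by rw [e3, zero_mul]))
  rw [affine_combination α β γ hsum] at hp0
  have ha1 := h1 a (mem_triSet_of_mem (by simp))
  have hb1 := h1 b (mem_triSet_of_mem (by simp))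
  have hc1 := h1 c (mem_triSet_of_mem (by simp))
  refine hP.orient_ne ha hb hc hab hac hbc (orient_eq_zero_of_affine h0 (a := a) (b := b) (c := c)
    (γ := γ) ?_ ?_ ?_)
  all_goals
    refine le_antisymm (by assumption) (le_of_not_gt fun hlt => ?_)
    nlinarith [mul_nonpos_of_nonneg_of_nonpos hx ha1, mul_nonpos_of_nonneg_of_nonpos hy hb1,
      mul_nonpos_of_nonneg_of_nonpos hz hc1, mul_neg_of_pos_of_neg hx' hlt,
      mul_neg_of_pos_of_neg hy' hlt, mul_neg_of_pos_of_neg hz' hlt]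

/-- A short initial piece of any segment in the hull lies in a single triangle. -/
theorem IsTriangulation.exists_initial_segment (hT : IsTriangulation P T) {y c : Pt}
    (hy : y ∈ convexHull ℝ P) (hc : c ∈ convexHull ℝ P) :
    ∃ ε : ℝ, 0 < ε ∧ ∃ t ∈ T, y ∈ triSet t ∧ (1 - ε) • y + ε • c ∈ triSet t := by
  have hev : ∀ᶠ x in nhds y, ∀ t ∈ T, y ∉ triSet t → x ∉ triSet t := by
    rw [Filter.eventually_all_finite hT.1]
    intro t _
    by_cases h : y ∈ triSet t
    · simp [h]
    · filter_upwards [(isClosed_triSet t).isOpen_compl.mem_nhds h] with x hx _ using hx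
  have hcont : Filter.Tendsto (fun ε : ℝ => (1 - ε) • y + ε • c) (nhds 0) (nhds y) :=
    Continuous.tendsto' (by fun_prop) _ _ (by simp)
  obtain ⟨ε, hε, hpos, hle⟩ := (((hcont.eventually hev).filter_mono nhdsWithin_le_nhds).and
    (Ioc_mem_nhdsGT (zero_lt_one' ℝ))).exists
  have hmem : (1 - ε) • y + ε • c ∈ convexHull ℝ P :=
    convex_convexHull ℝ P hy hc (by linarith) hpos.le (by ring)
  rw [← hT.2.2.2.2] at hmem
  obtain ⟨t, ht, hxt⟩ := mem_iUnion₂.1 hmem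
  exact ⟨ε, hpos, t, ht, by_contra fun h => hε t ht h hxt, hxt⟩

/-- The triangle on the other side of an edge. -/
theorem IsTriangulation.exists_neighbor (hT : IsTriangulation P T) (hP : Generic P)
    {a b c d : Pt} (ht : {a, b, d} ∈ T) (hc : c ∈ P)
    (h : orient a b c * orient a b d < 0) :
    ∃ e, {a, b, e} ∈ T ∧ 0 < orient a b c * orient a b e := by
  obtain ⟨⟨ha, hb, hd⟩, hab, had, hbd⟩ := hT.triple ht
  set y : Pt := (1 / 2 : ℝ) • a + (1 / 2 : ℝ) • b with hy
  have hy3 : y = (1 / 2 : ℝ) • a + (1 / 2 : ℝ) • b + (0 : ℝ) • d := by rw [zero_smul, add_zero]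
  have hyt : y ∈ triSet {a, b, d} :=
    mem_triSet.2 ⟨1 / 2, 1 / 2, 0, by norm_num, by norm_num, le_rfl, by norm_num, hy3⟩
  have hyP : y ∈ convexHull ℝ P :=
    convex_convexHull ℝ P (subset_convexHull ℝ _ ha) (subset_convexHull ℝ _ hb)
      (by norm_num) (by norm_num) (by norm_num)
  obtain ⟨ε, hε, s, hs, hys, hxs⟩ := hT.exists_initial_segment hyP (subset_convexHull ℝ _ hc)
  have hoy : orient a b y = 0 := by
    rw [hy3, orient_affine_combination a b (by norm_num), orient_self_left, orient_self_right]
    ring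
  have hox : orient a b ((1 - ε) • y + ε • c) = ε * orient a b c := by
    have := orient_affine_combination a b (a := y) (b := c) (c := c) (α := 1 - ε) (β := ε)
      (γ := 0) (by ring)
    rw [zero_smul, add_zero, zero_mul, add_zero, hoy, mul_zero, zero_add] at this
    exact this
  obtain ⟨e₁, e₂, e₃, -, -, -, rfl⟩ := Finset.card_eq_three.1 (hT.2.1 s hs).1
  have hst : ({a, b, d} : Finset Pt) ≠ {e₁, e₂, e₃} := by
    intro he
    rw [← he] at hxs
    obtain ⟨p, q, r, hp, hq, hr, hsum, hx⟩ := mem_triSet.1 hxs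
    rw [hx, orient_affine_combination a b hsum, orient_self_left, orient_self_right] at hox
    have h3 : r * (orient a b d * orient a b d) = ε * (orient a b c * orient a b d) := by
      linear_combination orient a b d * hox
    linarith [mul_neg_of_pos_of_neg hε h, mul_nonneg hr (mul_self_nonneg (orient a b d))]
  obtain ⟨α, β, γ, h0, h1, h2⟩ := hT.exists_separating_line hP ht hs hst
  have hLy := le_antisymm (h1 y hyt) (h2 y hys)
  have hLa := h1 a (mem_triSet_of_mem (by simp))
  have hLb := h1 b (mem_triSet_of_mem (by simp))
  have hLy' := hLy
  rw [hy3, affine_combination α β γ (by norm_num)] at hLy'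
  have hLa0 : α * a 0 + β * a 1 + γ = 0 := by linarith
  have hLb0 : α * b 0 + β * b 1 + γ = 0 := by linarith
  have hvert : ∀ e ∈ ({e₁, e₂, e₃} : Finset Pt), α * e 0 + β * e 1 + γ = 0 → e = a ∨ e = b := by
    intro e he hLe
    by_contra! hne
    exact hP.orient_ne ha hb ((hT.2.1 _ hs).2 he) hab hne.1.symm hne.2.symm
      (orient_eq_zero_of_affine h0 hLa0 hLb0 hLe)
  -- an edge of `s` through `y` lies on the separating line
  have hmem : a ∈ ({e₁, e₂, e₃} : Finset Pt) ∧ b ∈ ({e₁, e₂, e₃} : Finset Pt) := by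
    obtain ⟨p, q, r, hp, hq, hr, hsum, hyeq⟩ := mem_triSet.1 hys
    have hL := hLy
    rw [hyeq, affine_combination α β γ hsum] at hL
    have l1 := h2 e₁ (mem_triSet_of_mem (by simp))
    have l2 := h2 e₂ (mem_triSet_of_mem (by simp))
    have l3 := h2 e₃ (mem_triSet_of_mem (by simp))
    have m1 := mul_nonneg hp l1
    have m2 := mul_nonneg hq l2
    have m3 := mul_nonneg hr l3
    have n1 : p = 0 ∨ e₁ = a ∨ e₁ = b :=
      (mul_eq_zero.1 (by linarith)).imp_right (hvert e₁ (by simp))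
    have n2 : q = 0 ∨ e₂ = a ∨ e₂ = b :=
      (mul_eq_zero.1 (by linarith)).imp_right (hvert e₂ (by simp))
    have n3 : r = 0 ∨ e₃ = a ∨ e₃ = b :=
      (mul_eq_zero.1 (by linarith)).imp_right (hvert e₃ (by simp))
    have aux : ∀ z : Pt, (p = 0 ∨ e₁ = z) → (q = 0 ∨ e₂ = z) → (r = 0 ∨ e₃ = z) → y = z := by
      intro z g1 g2 g3
      have : y = (p + q + r) • z := by
        rw [hyeq, add_smul, add_smul]
        congr 1; congr 1
        · rcases g1 with g | g <;> simp [g]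
        · rcases g2 with g | g <;> simp [g]
        · rcases g3 with g | g <;> simp [g]
      rwa [hsum, one_smul] at this
    have half : ∀ z w : Pt, (1 / 2 : ℝ) • z + (1 / 2 : ℝ) • w = z → w = z := by
      intro z w hzw
      ext i
      have := congrArg (fun v : Pt => v i) hzw
      simp only [PiLp.add_apply, PiLp.smul_apply, smul_eq_mul] at this
      linarith
    constructor
    · by_contra hna
      simp only [Finset.mem_insert, Finset.mem_singleton, not_or] at hna
      have := aux b (n1.imp_right fun g => g.resolve_left (Ne.symm hna.1))
        (n2.imp_right fun g => g.resolve_left (Ne.symm hna.2.1))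
        (n3.imp_right fun g => g.resolve_left (Ne.symm hna.2.2))
      rw [hy, add_comm] at this
      exact hab (half b a this)
    · by_contra hnb
      simp only [Finset.mem_insert, Finset.mem_singleton, not_or] at hnb
      have := aux a (n1.imp_right fun g => g.resolve_right (Ne.symm hnb.1))
        (n2.imp_right fun g => g.resolve_right (Ne.symm hnb.2.1))
        (n3.imp_right fun g => g.resolve_right (Ne.symm hnb.2.2))
      exact hab (half a b this).symm
  obtain ⟨e, he⟩ := exists_eq_triple (hT.2.1 _ hs).1 hmem.1 hmem.2 hab
  rw [he] at hs hxs
  refine ⟨e, hs, ?_⟩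
  obtain ⟨p, q, r, hp, hq, hr, hsum, hx⟩ := mem_triSet.1 hxs
  rw [hx, orient_affine_combination a b hsum, orient_self_left, orient_self_right] at hox
  have hc0 : orient a b c ≠ 0 := left_ne_zero_of_mul h.ne
  have h3 : r * (orient a b c * orient a b e) = ε * (orient a b c * orient a b c) := by
    linear_combination orient a b c * hox
  have h4 : 0 < r * (orient a b c * orient a b e) := by
    rw [h3]; exact mul_pos hε (mul_self_pos.2 hc0)
  exact (pos_iff_pos_of_mul_pos h4).1 (hr.lt_of_ne (by rintro rfl; simp at h4))

/-- Starting at `u` towards `v`, either `uv` is an edge or the first triangle is crossed. -/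
theorem IsTriangulation.edge_or_crossing (hT : IsTriangulation P T) (hP : Generic P) {u v : Pt}
    (hu : u ∈ P) (hv : v ∈ P) (huv : u ≠ v) : (∃ t ∈ T, u ∈ t ∧ v ∈ t) ∨
      ∃ a b, {a, b, u} ∈ T ∧ 0 < orient u v a ∧ orient u v b < 0 ∧ 0 < orient a b v ∧
        orient a b u < 0 := by
  obtain ⟨ε, hε, t, ht, hut, hxt⟩ := hT.exists_initial_segment
    (subset_convexHull ℝ _ hu) (subset_convexHull ℝ _ hv)
  have hut' : u ∈ t := by
    obtain ⟨a, b, c, -, -, -, rfl⟩ := Finset.card_eq_three.1 (hT.2.1 t ht).1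
    simpa using hT.eq_of_mem_triSet hP ht hu hut
  by_cases hvt : v ∈ t
  · exact Or.inl ⟨t, ht, hut', hvt⟩
  right
  obtain ⟨a, b, rfl⟩ := exists_eq_triple_of_mem (hT.2.1 t ht).1 hut'
  obtain ⟨⟨-, ha, hb⟩, hua, hub, hab⟩ := hT.triple ht
  simp only [Finset.mem_insert, Finset.mem_singleton, not_or] at hvt
  have hoa := hP.orient_ne hu hv ha huv hua hvt.2.1
  have hob := hP.orient_ne hu hv hb huv hub hvt.2.2
  obtain ⟨p, q, r, hp, hq, hr, hsum, hx⟩ := mem_triSet.1 hxt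
  have ex : ∀ w z : Pt, orient w z ((1 - ε) • u + ε • v) =
      (1 - ε) * orient w z u + ε * orient w z v := by
    intro w z
    have := orient_affine_combination w z (a := u) (b := v) (c := v) (α := 1 - ε) (β := ε)
      (γ := 0) (by ring)
    rwa [zero_smul, add_zero, zero_mul, add_zero] at this
  have e1 : q * orient u v a + r * orient u v b = 0 := by
    have := ex u v
    rw [hx, orient_affine_combination u v hsum, orient_self_left, orient_self_right] at this
    linarith
  have e2 : r * orient u a b = -(ε * orient u v a) := by
    have := ex u a
    rw [hx, orient_affine_combination u a hsum, orient_self_left, orient_self_right,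
      orient_swap_right u v a] at this
    linarith
  have e3 : q * orient u a b = ε * orient u v b := by
    have := ex u b
    rw [hx, orient_affine_combination u b hsum, orient_self_left, orient_self_right,
      orient_swap_right u a b, orient_swap_right u v b] at this
    linarith
  have hq' : 0 < q := hq.lt_of_ne (by
    rintro rfl; rw [zero_mul] at e3; exact mul_ne_zero hε.ne' hob e3.symm)
  have hr' : 0 < r := hr.lt_of_ne (by
    rintro rfl; rw [zero_mul] at e2; exact mul_ne_zero hε.ne' hoa (by linarith))
  clear e1 ex hx hxt hsum hut hut'
  wlog hpos : 0 < orient u v a generalizing a b p q r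
  · have hneg : orient u v a < 0 := lt_of_le_of_ne (not_lt.1 hpos) hoa
    have hpos' : 0 < orient u v b := by
      have h1 : 0 < orient u a b := by nlinarith
      nlinarith
    exact this b a (by rwa [Finset.pair_comm]) hb ha hub hua
      hab.symm ⟨hvt.1, hvt.2.2, hvt.2.1⟩ hob hoa p r q hp hr hq
      (by rw [orient_swap_right]; linarith) (by rw [orient_swap_right]; linarith) hr' hq' hpos'
  have h1 : orient u a b < 0 := by nlinarith
  have h2 : orient u v b < 0 := by nlinarith
  have htr : ({u, a, b} : Finset Pt) = {a, b, u} := by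
    rw [Finset.insert_comm, Finset.pair_comm]
  refine ⟨a, b, htr ▸ ht, hpos, h2, ?_, by rwa [orient_rotate]⟩
  by_contra hneg
  have hmem : v ∈ triSet {u, b, a} := by
    refine mem_triSet_of_orient (by rw [orient_swap_right]; linarith) ?_ ?_ ?_
    · rw [orient_swap]; linarith
    · rw [← orient_rotate]; exact hpos.le
    · rw [orient_swap_right]; linarith
  rw [Finset.pair_comm] at hmem
  have := hT.eq_of_mem_triSet hP ht hv hmem
  tauto

end

/-! ### Forced edges of order-1 Delaunay triangulations -/

/-- `pqrs` is a convex counterclockwise quadrilateral such that the circumcircle of any three of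
its vertices encloses no point of `P` other than possibly the fourth vertex. -/
structure IsQuad (P : Set Pt) (p q r s : Pt) : Prop where
  mem : p ∈ P ∧ q ∈ P ∧ r ∈ P ∧ s ∈ P
  pqr : 0 < orient p q r
  pqs : 0 < orient p q s
  prs : 0 < orient p r s
  qrs : 0 < orient q r s
  circ : ∀ w ∈ P, w ≠ p → w ≠ q → w ≠ r → w ≠ s →
    0 < circleDet p q r w ∧ 0 < circleDet p q s w ∧ 0 < circleDet p r s w ∧ 0 < circleDet q r s w

theorem ne_of_orient_ne_zero {a b c : Pt} (h : orient a b c ≠ 0) : a ≠ b ∧ a ≠ c ∧ b ≠ c := by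
  refine ⟨?_, ?_, ?_⟩ <;> rintro rfl
  · exact h (orient_self _ _)
  · exact h (orient_self_left _ _)
  · exact h (orient_self_right _ _)

section

variable {P : Set Pt} {T : Set (Finset Pt)} {p q r s u v a b : Pt}

theorem IsQuad.rotate (h : IsQuad P p q r s) : IsQuad P q r s p := by
  refine ⟨⟨h.mem.2.1, h.mem.2.2.1, h.mem.2.2.2, h.mem.1⟩, h.qrs, ?_, ?_, ?_,
    fun w hw h1 h2 h3 h4 => ?_⟩
  · rw [orient_rotate]; exact h.pqr
  · rw [orient_rotate]; exact h.pqs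
  · rw [orient_rotate]; exact h.prs
  · obtain ⟨c1, c2, c3, c4⟩ := h.circ w hw h4 h1 h2 h3
    rw [circleDet_rotate p q r, circleDet_rotate p q s, circleDet_rotate p r s]
    exact ⟨c4, c1, c2, c3⟩

theorem IsQuad.orderKTri (h : IsQuad P p q r s) : OrderKTri P 1 {p, q, r} := by
  obtain ⟨z, ρ, hp, hq, hr⟩ := exists_circumcircle h.pqr.ne'
  refine ⟨z, ρ, by simp [hp, hq, hr], ?_⟩
  refine (Set.encard_le_encard (t := {s}) fun w hw => ?_).trans (by simp)
  by_contra hws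
  have hρ : 0 ≤ ρ := hp ▸ dist_nonneg
  have hneg := (power_neg_iff hρ).2 hw.2
  have hc := (h.circ w hw.1 (by rintro rfl; exact hw.2.ne hp) (by rintro rfl; exact hw.2.ne hq)
    (by rintro rfl; exact hw.2.ne hr) hws).1
  rw [circleDet_eq_power z ρ, power_eq_zero hp, power_eq_zero hq, power_eq_zero hr] at hc
  nlinarith [mul_neg_of_pos_of_neg h.pqr hneg]

/-- The edge `uv` of a quadrilateral to its left is locally Delaunay. -/
theorem IsQuad.circleDet_pos (h : IsQuad P u v r s) (ha : a ∈ P) (hb : b ∈ P)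
    (hua : 0 < orient u v a) (hub : orient u v b < 0) : 0 < circleDet u v a b := by
  have hne := ne_of_orient_ne_zero hub.ne
  have hcb := h.circ b hb hne.2.1.symm hne.2.2.symm
    (by rintro rfl; exact hub.not_gt h.pqr) (by rintro rfl; exact hub.not_gt h.pqs)
  by_cases har : a = r
  · rw [har]; exact hcb.1
  by_cases has : a = s
  · rw [has]; exact hcb.2.1
  have hne' := ne_of_orient_ne_zero hua.ne'
  have hca := (h.circ a ha hne'.2.1.symm hne'.2.2.symm har has).1
  have := orient_mul_circleDet u v r a b
  refine (pos_iff_pos_of_mul_pos (a := orient u v r) ?_).1 h.pqr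
  rw [this]
  nlinarith [mul_pos hua hcb.1, mul_pos_of_neg_of_neg hub (neg_neg_of_pos hca)]

theorem IsOrderDT.exists_power (hT : IsOrderDT P 1 T) {t : Finset Pt} (ht : t ∈ T) :
    ∃ z ρ, (∀ p ∈ t, power z ρ p = 0) ∧ {w ∈ P | power z ρ w < 0}.Subsingleton :=
  (hT.2 t ht).exists_power (Finset.card_pos.1 (by rw [(hT.1.2.1 t ht).1]; norm_num))

theorem orient_mul_power {z₁ z₂ : Pt} {ρ₁ ρ₂ : ℝ} {a b c w : Pt} (ha : power z₁ ρ₁ a = 0)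
    (hb : power z₁ ρ₁ b = 0) (ha' : power z₂ ρ₂ a = 0) (hb' : power z₂ ρ₂ b = 0) :
    orient a b c * power z₁ ρ₁ w - orient a b w * power z₁ ρ₁ c =
      orient a b c * power z₂ ρ₂ w - orient a b w * power z₂ ρ₂ c := by
  have h1 := circleDet_eq_power z₁ ρ₁ a b c w
  have h2 := circleDet_eq_power z₂ ρ₂ a b c w
  rw [ha, hb] at h1
  rw [ha', hb'] at h2
  linear_combination h2 - h1

/-- If the locally Delaunay edge `uv` is absent from an order-1 triangulation, then it is crossed
by a single edge of the triangulation. -/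
theorem IsOrderDT.edge_or_exists_crossing (hT : IsOrderDT P 1 T) (hP : Generic P) (hu : u ∈ P)
    (hv : v ∈ P) (huv : u ≠ v) (hdel : ∀ a ∈ P, ∀ b ∈ P, 0 < orient u v a → orient u v b < 0 →
      0 < circleDet u v a b) : (∃ t ∈ T, u ∈ t ∧ v ∈ t) ∨
    ∃ a b, {a, b, u} ∈ T ∧ {a, b, v} ∈ T ∧ 0 < orient u v a ∧ orient u v b < 0 ∧
      0 < orient a b v ∧ orient a b u < 0 := by
  have hex : ∀ t, ∃ z ρ, t ∈ T → (∀ p ∈ t, power z ρ p = 0) ∧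
      {w ∈ P | power z ρ w < 0}.Subsingleton := by
    intro t
    by_cases ht : t ∈ T
    · obtain ⟨z, ρ, h⟩ := hT.exists_power ht
      exact ⟨z, ρ, fun _ => h⟩
    · exact ⟨0, 0, fun h => absurd h ht⟩
  choose z ρ hz using hex
  have hdet : ∀ t ∈ T, ∀ a ∈ t, ∀ b ∈ t, 0 < orient u v a → orient u v b < 0 →
      0 < orient a b u * power (z t) (ρ t) v - orient a b v * power (z t) (ρ t) u := by
    intro t ht a ha b hb hua hub
    have h := hdel a ((hT.1.2.1 t ht).2 ha) b ((hT.1.2.1 t ht).2 hb) hua hub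
    rw [circleDet_eq_power (z t) (ρ t), (hz t ht).1 a ha, (hz t ht).1 b hb] at h
    rw [orient_rotate u a b, orient_rotate v a b]
    linarith
  rcases hT.1.edge_or_crossing hP hu hv huv with h | ⟨a₀, b₀, ht₀, ha₀, hb₀, hv₀, hu₀⟩
  · exact Or.inl h
  right
  set S : Set (Finset Pt) := {t ∈ T | 0 ≤ power (z t) (ρ t) u ∧ power (z t) (ρ t) v < 0 ∧
    ∃ a b d, t = {a, b, d} ∧ 0 < orient u v a ∧ orient u v b < 0 ∧ 0 < orient a b v ∧
      orient a b u < 0 ∧ orient a b d < 0} with hS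
  have hS₀ : {a₀, b₀, u} ∈ S := by
    have h0 := (hz _ ht₀).1 u (by simp)
    have h1 := hdet _ ht₀ a₀ (by simp) b₀ (by simp) ha₀ hb₀
    rw [h0, mul_zero, sub_zero] at h1
    exact ⟨ht₀, h0.ge, neg_of_mul_pos_right h1 hu₀.le, a₀, b₀, u, rfl, ha₀, hb₀, hv₀, hu₀, hu₀⟩
  obtain ⟨t, ⟨ht, htu, htv, a, b, d, rfl, hua, hub, habv, habu, habd⟩, hmax⟩ :=
    Set.exists_max_image S (fun t => power (z t) (ρ t) u) (hT.1.1.subset fun t h => h.1) ⟨_, hS₀⟩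
  obtain ⟨c, hc, hcpos⟩ := hT.1.exists_neighbor hP ht hv (mul_neg_of_pos_of_neg habv habd)
  have habc : 0 < orient a b c := (pos_iff_pos_of_mul_pos hcpos).1 habv
  obtain ⟨⟨haP, hbP, hcP⟩, hab, hac, hbc⟩ := hT.1.triple hc
  obtain ⟨⟨-, -, hdP⟩, -, had, hbd⟩ := hT.1.triple ht
  have hcd : c ≠ d := by rintro rfl; exact habd.not_gt habc
  have hft := hz _ ht
  have hfc := hz _ hc
  have hdt := hdet _ ht a (by simp) b (by simp) hua hub
  have hdc := hdet _ hc a (by simp) b (by simp) hua hub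
  have hcd0 : circleDet a b d c ≠ 0 :=
    hP.circleDet_ne haP hbP hdP hcP hab had hac hbd hbc hcd.symm
  rw [circleDet_eq_power (z {a, b, d}) (ρ {a, b, d}), hft.1 a (by simp), hft.1 b (by simp),
    hft.1 d (by simp)] at hcd0
  have hrel := fun w => orient_mul_power (c := c) (w := w) (hft.1 a (by simp))
    (hft.1 b (by simp)) (hfc.1 a (by simp)) (hfc.1 b (by simp))
  have hfd := hft.1 d (by simp)
  have hfcc := hfc.1 c (by simp)
  have hmaxc := hmax {a, b, c}
  have hsub := hft.2
  have hsub' := hfc.2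
  rw [hS] at hmaxc
  simp only [mem_ofPred_eq] at hmaxc
  clear hmax hft hfc hS hS₀ hdet
  generalize power (z {a, b, d}) (ρ {a, b, d}) = f at *
  generalize power (z {a, b, c}) (ρ {a, b, c}) = g at *
  by_cases hcv : c = v
  · subst hcv
    rw [hfcc, mul_zero, zero_sub] at hdc
    have hgu : g u < 0 := by
      by_contra h
      linarith [mul_nonneg habv.le (not_lt.1 h)]
    by_cases hdu : d = u
    · subst hdu
      exact ⟨a, b, ht, hc, hua, hub, habv, habu⟩
    have hgd : 0 ≤ g d := by
      by_contra h
      exact hdu (hsub' ⟨hdP, not_le.1 h⟩ ⟨hu, hgu⟩)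
    have h := hrel d
    rw [hfd, hfcc] at h
    linarith [mul_pos_of_neg_of_neg habd htv, mul_nonneg habv.le hgd]
  exfalso
  have hfcpos : 0 < f c := by
    refine lt_of_le_of_ne (le_of_not_gt fun h => hcv (hsub ⟨hcP, h⟩ ⟨hv, htv⟩)) fun h => ?_
    rw [← h] at hcd0
    simp at hcd0
  have hgu : f u < g u := by
    have h := hrel u
    rw [hfcc, mul_zero, sub_zero] at h
    refine lt_of_mul_lt_mul_left (a := orient a b c) ?_ habc.le
    linarith [mul_neg_of_neg_of_pos habu hfcpos]
  have hgv : g v < 0 := by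
    have : 0 < orient a b u * g v := by
      linarith [mul_pos habv (htu.trans_lt hgu)]
    exact neg_of_mul_pos_right this habu.le
  have hcu : c ≠ u := by rintro rfl; exact habu.not_gt habc
  have hout : ¬ (0 ≤ orient b c v ∧ 0 ≤ orient c a v) := by
    rintro ⟨h1, h2⟩
    rcases hT.1.eq_of_mem_triSet hP hc hv (mem_triSet_of_orient habc h1 h2 habv.le) with h | h | h
    · rw [h, orient_self_left] at habv
      exact habv.false
    · rw [h, orient_self_right] at habv
      exact habv.false
    · exact hcv h.symm
  have hbv := orient_barycentric a b c u v v
  have hbu := orient_barycentric a b c u v u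
  rw [orient_self_right, mul_zero] at hbv
  rw [orient_self_left, mul_zero] at hbu
  have hsu := orient_add_orient_add_orient a b c u
  rcases (hP.orient_ne hu hv hcP huv hcu.symm (Ne.symm hcv)).lt_or_gt with hcr | hcl
  · have p1 : orient c a v < 0 := by
      by_contra h
      push Not at h
      have : 0 < orient b c v * orient u v a := by
        linarith [mul_neg_of_pos_of_neg habv hcr, mul_nonpos_of_nonneg_of_nonpos h hub.le]
      exact hout ⟨(pos_of_mul_pos_left this hua.le).le, h⟩
    have p2 : 0 < orient c a u := by
      by_contra h
      push Not at h
      have : orient b c u * orient u v a < 0 := by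
        linarith [mul_pos_of_neg_of_neg habu hcr, mul_nonneg_of_nonpos_of_nonpos h hub.le]
      linarith [neg_of_mul_neg_left this hua.le]
    refine (hmaxc ⟨hc, (htu.trans_lt hgu).le, hgv, a, c, b, by rw [Finset.pair_comm], hua, hcr,
      ?_, ?_, ?_⟩).not_gt hgu
    · rw [orient_swap]; linarith
    · rw [orient_swap]; linarith
    · rw [orient_swap_right]; linarith
  · have p1 : orient b c v < 0 := by
      by_contra h
      push Not at h
      have : orient c a v * orient u v b < 0 := by
        linarith [mul_pos habv hcl, mul_nonneg h hua.le]
      exact hout ⟨h, (pos_of_mul_neg_left this hub.le).le⟩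
    have p2 : 0 < orient b c u := by
      by_contra h
      push Not at h
      have : 0 < orient c a u * orient u v b := by
        linarith [mul_neg_of_neg_of_pos habu hcl, mul_nonpos_of_nonpos_of_nonneg h hua.le]
      linarith [neg_of_mul_pos_left this hub.le]
    refine (hmaxc ⟨hc, (htu.trans_lt hgu).le, hgv, c, b, a, ?_, hcl, hub,
      ?_, ?_, ?_⟩).not_gt hgu
    · rw [Finset.insert_comm, Finset.pair_comm, Finset.insert_comm]
    · rw [orient_swap]; linarith
    · rw [orient_swap]; linarith
    · rw [← orient_rotate, orient_swap]; linarith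

/-- A vertex of an edge crossing `uv` is one of the two vertices of the quadrilateral. -/
theorem IsOrderDT.eq_of_crossing (hT : IsOrderDT P 1 T) (h : IsQuad P u v r s)
    (hu : {a, b, u} ∈ T) (hv : {a, b, v} ∈ T) (hua : 0 < orient u v a)
    (habv : 0 < orient a b v) (habu : orient a b u < 0) (hdel : 0 < circleDet u v a b) :
    a = r ∨ a = s := by
  by_contra! hne
  obtain ⟨⟨haP, hbP, huP⟩, hab, hau, hbu⟩ := hT.1.triple hu
  obtain ⟨⟨-, -, hvP⟩, -, hav, hbv⟩ := hT.1.triple hv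
  obtain ⟨z₁, ρ₁, h1, h1'⟩ := hT.exists_power hu
  obtain ⟨z₂, ρ₂, h2, h2'⟩ := hT.exists_power hv
  have hra := (h.circ a haP hau hav hne.1 hne.2).1
  have hr := h.mem.2.2.1
  have hru := ne_of_orient_ne_zero h.pqr.ne'
  have huv := hru.1
  have e1 := circleDet_eq_power z₁ ρ₁ u v a b
  have e2 := circleDet_eq_power z₂ ρ₂ u v a b
  have e3 := circleDet_eq_power z₁ ρ₁ u v a r
  have e4 := circleDet_eq_power z₂ ρ₂ u v a r
  rw [h1 a (by simp), h1 u (by simp)] at e1 e3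
  rw [h2 a (by simp), h2 v (by simp)] at e2 e4
  rw [h1 b (by simp)] at e1
  rw [h2 b (by simp)] at e2
  rw [← orient_rotate u a b] at e1
  rw [← orient_rotate v a b] at e2
  have f1v : power z₁ ρ₁ v < 0 := neg_of_mul_pos_right (by linarith) habu.le
  have f2u : power z₂ ρ₂ u < 0 := by
    by_contra hn
    linarith [mul_nonneg habv.le (not_lt.1 hn)]
  have f1r : 0 ≤ power z₁ ρ₁ r :=
    le_of_not_gt fun hn => hru.2.2.symm (h1' ⟨hr, hn⟩ ⟨hvP, f1v⟩)
  have f2r : 0 ≤ power z₂ ρ₂ r :=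
    le_of_not_gt fun hn => hru.2.1.symm (h2' ⟨hr, hn⟩ ⟨huP, f2u⟩)
  rw [circleDet_swap_right] at e3 e4
  have g1 : 0 < orient u a r :=
    pos_of_mul_neg_left (b := power z₁ ρ₁ v) (by linarith [mul_nonneg hua.le f1r]) f1v.le
  have g2 : orient v a r < 0 :=
    neg_of_mul_pos_left (b := power z₂ ρ₂ u) (by linarith [mul_nonneg hua.le f2r]) f2u.le
  have k := circleDet_mul_orient u v r a
  rw [← orient_rotate, ← orient_rotate] at g1
  rw [orient_swap_right] at g2
  have t1 := mul_pos hra h.pqr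
  have t2 : 0 < orient v r a := by linarith
  have : 0 ≤ orient v r a * orient r u a * ((u 0 - v 0) ^ 2 + (u 1 - v 1) ^ 2) +
        orient r u a * orient u v a * ((v 0 - r 0) ^ 2 + (v 1 - r 1) ^ 2) +
        orient u v a * orient v r a * ((r 0 - u 0) ^ 2 + (r 1 - u 1) ^ 2) := by positivity
  linarith

/-- A segment with a quadrilateral on each side, not crossed by any segment joining vertices of the
two quadrilaterals, is an edge of every order-1 Delaunay triangulation. -/
theorem IsOrderDT.exists_mem_of_isQuad (hT : IsOrderDT P 1 T) (hP : Generic P) {r' s' : Pt}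
    (h : IsQuad P u v r s) (h' : IsQuad P v u r' s')
    (hcross : ∀ a b, a = r ∨ a = s → b = r' ∨ b = s' →
      ¬ (orient a b u < 0 ∧ 0 < orient a b v)) : ∃ t ∈ T, u ∈ t ∧ v ∈ t := by
  have huv := (ne_of_orient_ne_zero h.pqr.ne').1
  have hdel := fun a (ha : a ∈ P) b (hb : b ∈ P) => h.circleDet_pos ha hb
  refine (hT.edge_or_exists_crossing hP h.mem.1 h.mem.2.1 huv hdel).resolve_right ?_
  rintro ⟨a, b, hu, hv, hua, hub, habv, habu⟩
  obtain ⟨⟨haP, hbP, -⟩, -⟩ := hT.1.triple hu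
  have hc := hdel a haP b hbP hua hub
  refine hcross a b (hT.eq_of_crossing h hu hv hua habv habu hc)
    (hT.eq_of_crossing h' (by rwa [Finset.insert_comm]) (by rwa [Finset.insert_comm]) ?_ ?_ ?_ ?_)
    ⟨habu, habv⟩
  · rw [orient_swap]; linarith
  · rw [orient_swap]; linarith
  · rw [orient_swap]; linarith
  · have : circleDet v u b a = circleDet u v a b := by simp only [circleDet, orient]; ring
    rwa [this]

end

/-! ### Counting triangulations that refine a quadrangulation -/

/-- The triangulation of the quadrilateral `pqrs` by the diagonal `pr`. -/
def diagonalTriangles (p q r s : Pt) : Set (Finset Pt) := {{p, q, r}, {r, s, p}}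

section

variable {P : Set Pt} {T : Set (Finset Pt)} {p q r s w x : Pt}

theorem triple_rotate (a b c : Pt) : ({b, c, a} : Finset Pt) = {a, b, c} := by
  rw [Finset.pair_comm, Finset.insert_comm]

theorem IsTriangulation.eq_of_subset {T' : Set (Finset Pt)} (hT : IsTriangulation P T)
    (hT' : IsTriangulation P T') (hP : Generic P) (h : T' ⊆ T) : T' = T := by
  refine h.antisymm fun t ht => ?_
  by_contra hnt
  obtain ⟨x, hx⟩ := hT.interior_nonempty hP ht
  have hxP : x ∈ convexHull ℝ P := by
    rw [← hT.2.2.2.2]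
    exact mem_iUnion₂.2 ⟨t, ht, interior_subset hx⟩
  rw [← hT'.2.2.2.2] at hxP
  obtain ⟨s, hs, hxs⟩ := mem_iUnion₂.1 hxP
  have hcl : x ∈ closure (interior (triSet s)) := by
    have hconv : Convex ℝ (triSet s) := convex_convexHull ℝ _
    rw [hconv.closure_interior_eq_closure_of_nonempty_interior
      (hT'.interior_nonempty hP hs)]
    exact subset_closure hxs
  have hne := mem_closure_iff.1 hcl _ isOpen_interior hx
  rw [hT.2.2.2.1 ht (h hs) (by rintro rfl; exact hnt hs)] at hne
  exact Set.not_nonempty_empty hne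

theorem IsQuad.notMem_of_mem (h : IsQuad P p q r s) (hT : IsTriangulation P T)
    (h1 : {p, q, r} ∈ T) : {q, r, s} ∉ T := by
  intro h2
  have hpq := ne_of_orient_ne_zero h.pqr.ne'
  have hps := ne_of_orient_ne_zero h.pqs.ne'
  have hpr : 0 < orient q r p := by rw [orient_rotate]; exact h.pqr
  rw [← triple_rotate] at h1
  refine interior_inter_interior_ne_empty (mul_pos hpr h.qrs) (hT.2.2.2.1 h1 h2 fun he => ?_)
  have : p ∈ ({q, r, s} : Finset Pt) := he ▸ by simp
  simp [hpq.1, hpq.2.1, hps.2.1] at this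

theorem IsQuad.eq_or_eq_of_mem (h : IsQuad P p q r s) (hT : IsOrderDT P 1 T)
    (hw : {p, q, w} ∈ T) (hpos : 0 < orient p q w) : w = r ∨ w = s := by
  by_contra! hne
  obtain ⟨⟨-, -, hwP⟩, -, hpw, hqw⟩ := hT.1.triple hw
  obtain ⟨z, ρ, h0, hsub⟩ := hT.exists_power hw
  obtain ⟨c1, c2, -⟩ := h.circ w hwP hpw.symm hqw.symm hne.1 hne.2
  have key : ∀ x, 0 < circleDet p q x w → power z ρ x < 0 := by
    intro x hx
    have := circleDet_eq_power z ρ p q w x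
    rw [h0 p (by simp), h0 q (by simp), h0 w (by simp), circleDet_swap_right] at this
    exact neg_of_mul_neg_right (a := orient p q w) (by linarith) hpos.le
  exact (ne_of_orient_ne_zero h.qrs.ne').2.2
    (hsub ⟨h.mem.2.2.1, key r c1⟩ ⟨h.mem.2.2.2, key s c2⟩)

theorem IsQuad.diagonalTriangles_subset (h : IsQuad P p q r s) (hT : IsOrderDT P 1 T)
    (h1 : ∃ w, {p, q, w} ∈ T ∧ 0 < orient p q w) (h2 : ∃ w, {r, s, w} ∈ T ∧ 0 < orient r s w) :
    diagonalTriangles p q r s ⊆ T ∨ diagonalTriangles q r s p ⊆ T := by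
  obtain ⟨w, hw, hpos⟩ := h1
  obtain ⟨w', hw', hpos'⟩ := h2
  simp only [diagonalTriangles, Set.insert_subset_iff, Set.singleton_subset_iff]
  rcases h.eq_or_eq_of_mem hT hw hpos with rfl | rfl <;>
    rcases h.rotate.rotate.eq_or_eq_of_mem hT hw' hpos' with rfl | rfl
  · exact Or.inl ⟨hw, hw'⟩
  · rw [triple_rotate] at hw'
    exact absurd hw' (h.notMem_of_mem hT.1 hw)
  · rw [triple_rotate] at hw
    exact absurd hw (h.rotate.rotate.notMem_of_mem hT.1 hw')
  · rw [triple_rotate] at hw hw'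
    exact Or.inr ⟨hw', hw⟩

theorem IsQuad.exists_mem_diagonalTriangles (h : IsQuad P p q r s) (h1 : 0 ≤ orient p q x)
    (h2 : 0 ≤ orient q r x) (h3 : 0 ≤ orient r s x) (h4 : 0 ≤ orient s p x) :
    ∃ t ∈ diagonalTriangles p q r s, x ∈ triSet t := by
  rcases le_total (orient p r x) 0 with h0 | h0
  · exact ⟨_, Or.inl rfl, mem_triSet_of_orient h.pqr h2 (by rw [orient_swap]; linarith) h1⟩
  · exact ⟨_, Or.inr rfl, mem_triSet_of_orient h.rotate.rotate.pqr h4 h0 h3⟩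

end

section

variable {P : Set Pt} {κ : Type*} {p q r s : κ → Pt}

/-- The triangles obtained by choosing a diagonal in each quadrilateral. -/
def choiceTriangles (p q r s : κ → Pt) (χ : κ → Bool) : Set (Finset Pt) :=
  ⋃ k, bif χ k then diagonalTriangles (p k) (q k) (r k) (s k)
    else diagonalTriangles (q k) (r k) (s k) (p k)

/-- Two finite sets lie on different sides of a line. -/
def SeparatedByLine (s t : Finset Pt) : Prop :=
  ∃ a b, a ≠ b ∧ (∀ x ∈ s, 0 ≤ orient a b x) ∧ ∀ x ∈ t, orient a b x ≤ 0

theorem SeparatedByLine.symm {s t : Finset Pt} (h : SeparatedByLine s t) :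
    SeparatedByLine t s := by
  obtain ⟨a, b, hab, h1, h2⟩ := h
  refine ⟨b, a, hab.symm, fun x hx => ?_, fun x hx => ?_⟩
  · rw [orient_swap]; linarith [h2 x hx]
  · rw [orient_swap]; linarith [h1 x hx]

/-- A convex quadrangulation of the convex hull of `P`. -/
structure IsQuadrangulation (P : Set Pt) (p q r s : κ → Pt) : Prop where
  isQuad : ∀ k, IsQuad P (p k) (q k) (r k) (s k)
  separated : ∀ k l, k ≠ l → SeparatedByLine {p k, q k, r k, s k} {p l, q l, r l, s l}
  cover : ∀ x ∈ convexHull ℝ P, ∃ k, 0 ≤ orient (p k) (q k) x ∧ 0 ≤ orient (q k) (r k) x ∧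
    0 ≤ orient (r k) (s k) x ∧ 0 ≤ orient (s k) (p k) x
  vertex : ∀ x ∈ P, ∃ k, x ∈ ({p k, q k, r k, s k} : Finset Pt)

theorem choiceTriangles_subset_iff {χ : κ → Bool} {T : Set (Finset Pt)} :
    choiceTriangles p q r s χ ⊆ T ↔ ∀ k, (bif χ k then diagonalTriangles (p k) (q k) (r k) (s k)
      else diagonalTriangles (q k) (r k) (s k) (p k)) ⊆ T :=
  iUnion_subset_iff

theorem subset_of_mem_diagonalTriangles {p q r s : Pt} {t : Finset Pt}
    (h : t ∈ diagonalTriangles p q r s) : t ⊆ {p, q, r, s} := by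
  rcases h with rfl | rfl <;> intro x <;> simp <;> tauto

theorem IsQuad.isOrderTri {p q r s : Pt} (h : IsQuad P p q r s) {t : Finset Pt}
    (ht : t ∈ diagonalTriangles p q r s) : t.card = 3 ∧ (t : Set Pt) ⊆ P ∧ OrderKTri P 1 t := by
  have key : ∀ {p q r s}, IsQuad P p q r s →
      ({p, q, r} : Finset Pt).card = 3 ∧ (({p, q, r} : Finset Pt) : Set Pt) ⊆ P ∧
        OrderKTri P 1 {p, q, r} := by
    intro p q r s h
    obtain ⟨h1, h2, h3⟩ := ne_of_orient_ne_zero h.pqr.ne'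
    refine ⟨Finset.card_eq_three.2 ⟨p, q, r, h1, h2, h3, rfl⟩, ?_, h.orderKTri⟩
    simp [Set.insert_subset_iff, h.mem]
  rcases ht with rfl | rfl
  · exact key h
  · exact key h.rotate.rotate

theorem IsQuad.pairwise_diagonalTriangles {p q r s : Pt} (h : IsQuad P p q r s) :
    (diagonalTriangles p q r s).Pairwise
      fun t u => interior (triSet t) ∩ interior (triSet u) = ∅ := by
  have hpr := (ne_of_orient_ne_zero h.prs.ne').1
  have h1 := h.pqr
  rw [← orient_rotate, ← orient_rotate, orient_swap] at h1
  have key : interior (triSet {r, s, p}) ∩ interior (triSet {p, q, r}) = ∅ := by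
    refine interior_inter_interior_eq_empty hpr ?_ ?_ <;> intro x hx <;>
      simp only [Finset.mem_insert, Finset.mem_singleton] at hx <;>
      rcases hx with rfl | rfl | rfl <;>
      try simp only [orient_self_left, orient_self_right, le_refl]
    · exact h.prs.le
    · linarith
  rintro t (rfl | rfl) u (rfl | rfl) hne
  · exact absurd rfl hne
  · rwa [inter_comm]
  · exact key
  · exact absurd rfl hne

theorem mem_choiceTriangles {χ : κ → Bool} {t : Finset Pt} :
    t ∈ choiceTriangles p q r s χ ↔
      ∃ k, (χ k = true ∧ t ∈ diagonalTriangles (p k) (q k) (r k) (s k)) ∨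
        (χ k = false ∧ t ∈ diagonalTriangles (q k) (r k) (s k) (p k)) := by
  rw [choiceTriangles, mem_iUnion]
  refine exists_congr fun k => ?_
  cases χ k <;> simp

theorem IsQuadrangulation.isOrderDT [Finite κ] (h : IsQuadrangulation P p q r s) (χ : κ → Bool) :
    IsOrderDT P 1 (choiceTriangles p q r s χ) := by
  have htri : ∀ t ∈ choiceTriangles p q r s χ,
      t.card = 3 ∧ (t : Set Pt) ⊆ P ∧ OrderKTri P 1 t := by
    intro t ht
    obtain ⟨k, ⟨-, ht⟩ | ⟨-, ht⟩⟩ := mem_choiceTriangles.1 ht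
    · exact (h.isQuad k).isOrderTri ht
    · exact (h.isQuad k).rotate.isOrderTri ht
  refine ⟨⟨?_, fun t ht => ⟨(htri t ht).1, (htri t ht).2.1⟩, fun x hx => ?_, ?_, ?_⟩,
    fun t ht => (htri t ht).2.2⟩
  · refine Set.finite_iUnion fun k => ?_
    cases χ k <;> simp [diagonalTriangles]
  · obtain ⟨k, hk⟩ := h.vertex x hx
    simp only [Finset.mem_insert, Finset.mem_singleton] at hk
    have aux : ∀ {p q r s : Pt}, (x = p ∨ x = q ∨ x = r ∨ x = s) →
        ∃ t ∈ diagonalTriangles p q r s, x ∈ t := by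
      rintro p q r s (rfl | rfl | rfl | rfl)
      · exact ⟨_, Or.inl rfl, by simp⟩
      · exact ⟨_, Or.inl rfl, by simp⟩
      · exact ⟨_, Or.inl rfl, by simp⟩
      · exact ⟨_, Or.inr rfl, by simp⟩
    cases hχ : χ k
    · obtain ⟨t, ht, hxt⟩ := aux (p := q k) (q := r k) (r := s k) (s := p k) (by tauto)
      exact ⟨t, mem_choiceTriangles.2 ⟨k, Or.inr ⟨hχ, ht⟩⟩, hxt⟩
    · obtain ⟨t, ht, hxt⟩ := aux hk
      exact ⟨t, mem_choiceTriangles.2 ⟨k, Or.inl ⟨hχ, ht⟩⟩, hxt⟩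
  · intro t ht u hu hne
    obtain ⟨k, hk⟩ := mem_choiceTriangles.1 ht
    obtain ⟨l, hl⟩ := mem_choiceTriangles.1 hu
    by_cases hkl : k = l
    · subst hkl
      rcases hk with ⟨hχ, hk⟩ | ⟨hχ, hk⟩ <;> rcases hl with ⟨hχ', hl⟩ | ⟨hχ', hl⟩
      · exact (h.isQuad k).pairwise_diagonalTriangles hk hl hne
      · simp [hχ] at hχ'
      · simp [hχ] at hχ'
      · exact (h.isQuad k).rotate.pairwise_diagonalTriangles hk hl hne
    · have aux : ∀ k t, (χ k = true ∧ t ∈ diagonalTriangles (p k) (q k) (r k) (s k)) ∨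
          (χ k = false ∧ t ∈ diagonalTriangles (q k) (r k) (s k) (p k)) →
          t ⊆ {p k, q k, r k, s k} := by
        rintro k t (⟨-, ht⟩ | ⟨-, ht⟩)
        · exact subset_of_mem_diagonalTriangles ht
        · refine (subset_of_mem_diagonalTriangles ht).trans fun x => ?_
          simp only [Finset.mem_insert, Finset.mem_singleton]
          tauto
      obtain ⟨a, b, hab, h1, h2⟩ := h.separated k l hkl
      exact interior_inter_interior_eq_empty hab (fun x hx => h1 x (aux k t hk hx))
        fun x hx => h2 x (aux l u hl hx)
  · refine subset_antisymm (iUnion₂_subset fun t ht => convexHull_mono (htri t ht).2.1)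
      fun x hx => ?_
    obtain ⟨k, h1, h2, h3, h4⟩ := h.cover x hx
    cases hχ : χ k
    · obtain ⟨t, ht, hxt⟩ := (h.isQuad k).rotate.exists_mem_diagonalTriangles h2 h3 h4 h1
      exact mem_iUnion₂.2 ⟨t, mem_choiceTriangles.2 ⟨k, Or.inr ⟨hχ, ht⟩⟩, hxt⟩
    · obtain ⟨t, ht, hxt⟩ := (h.isQuad k).exists_mem_diagonalTriangles h1 h2 h3 h4
      exact mem_iUnion₂.2 ⟨t, mem_choiceTriangles.2 ⟨k, Or.inl ⟨hχ, ht⟩⟩, hxt⟩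

theorem IsQuadrangulation.injective [Finite κ] (h : IsQuadrangulation P p q r s) :
    Function.Injective (choiceTriangles p q r s) := by
  have key : ∀ χ χ' k, choiceTriangles p q r s χ = choiceTriangles p q r s χ' →
      χ k = true → χ' k = true := by
    intro χ χ' k he hk
    by_contra hk'
    refine (h.isQuad k).notMem_of_mem (h.isOrderDT χ).1
      (mem_choiceTriangles.2 ⟨k, Or.inl ⟨hk, Or.inl rfl⟩⟩) ?_
    rw [he]
    exact mem_choiceTriangles.2 ⟨k, Or.inr ⟨by simpa using hk', Or.inl rfl⟩⟩
  intro χ χ' he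
  funext k
  exact Bool.eq_iff_iff.2 ⟨key χ χ' k he, key χ' χ k he.symm⟩

/-- If every order-1 Delaunay triangulation has triangles inside each quadrilateral on two opposite
edges, then these triangulations correspond to the choices of diagonals. -/
theorem IsQuadrangulation.ncard_isOrderDT [Fintype κ] (h : IsQuadrangulation P p q r s)
    (hP : Generic P) (hedge : ∀ T, IsOrderDT P 1 T → ∀ k,
      (∃ w, {p k, q k, w} ∈ T ∧ 0 < orient (p k) (q k) w) ∧
        ∃ w, {r k, s k, w} ∈ T ∧ 0 < orient (r k) (s k) w) :
    {T : Set (Finset Pt) | IsOrderDT P 1 T}.ncard = 2 ^ Fintype.card κ := by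
  have hrange : {T : Set (Finset Pt) | IsOrderDT P 1 T} = range (choiceTriangles p q r s) := by
    ext T
    constructor
    · intro hT
      have hd := fun k => (h.isQuad k).diagonalTriangles_subset hT (hedge T hT k).1 (hedge T hT k).2
      have : ∀ k, ∃ d : Bool, (bif d then diagonalTriangles (p k) (q k) (r k) (s k)
          else diagonalTriangles (q k) (r k) (s k) (p k)) ⊆ T := fun k =>
        (hd k).elim (fun h => ⟨true, h⟩) fun h => ⟨false, h⟩
      choose χ hχ using this
      exact ⟨χ, hT.1.eq_of_subset (h.isOrderDT χ).1 hP (choiceTriangles_subset_iff.2 hχ)⟩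
    · rintro ⟨χ, rfl⟩
      exact h.isOrderDT χ
  rw [hrange, ← Set.image_univ, Set.ncard_image_of_injective _ h.injective, Set.ncard_univ,
    Nat.card_fun]
  simp

end

/-! ### Nested rings of four points -/

/-- The points of the first `m + 1` rings. -/
def ringPoints (m : ℕ) (q : ℕ × Fin 4 → Pt) : Set Pt := q '' {x | x.1 ≤ m}

/-- The point `w` lies strictly outside the circles through any three of
the four given points, which are listed in counterclockwise order. -/
def OutsideCircles (p q r s w : Pt) : Prop :=
  0 < circleDet p q r w ∧ 0 < circleDet p q s w ∧ 0 < circleDet p r s w ∧ 0 < circleDet q r s w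

/-- Strict inequalities describing nested convex quadrilaterals whose corners are roughly aligned
along four rays. -/
structure IsRingConfig (m : ℕ) (q : ℕ × Fin 4 → Pt) : Prop where
  inner : ∀ i ≤ m, ∀ k, ∀ j ≤ i, ∀ l, j < i ∨ (l ≠ k ∧ l ≠ k + 1) →
    0 < orient (q (i, k)) (q (i, k + 1)) (q (j, l))
  outer : ∀ i < m, ∀ k, 0 < orient (q (i, k + 1)) (q (i, k)) (q (i + 1, k)) ∧
    0 < orient (q (i, k + 1)) (q (i, k)) (q (i + 1, k + 1))
  opposite : ∀ i < m, ∀ k, 0 < orient (q (i, k)) (q (i, k + 1)) (q (i + 1, k + 2)) ∧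
    0 < orient (q (i, k)) (q (i, k + 1)) (q (i + 1, k + 3))
  left : ∀ i < m, ∀ k, 0 < orient (q (i, k)) (q (i + 1, k)) (q (i, k + 1)) ∧
    0 < orient (q (i, k)) (q (i + 1, k)) (q (i + 1, k + 1))
  right : ∀ i < m, ∀ k, 0 < orient (q (i + 1, k)) (q (i, k)) (q (i, k + 3)) ∧
    0 < orient (q (i + 1, k)) (q (i, k)) (q (i + 1, k + 3))
  growth_left : ∀ i < m, ∀ k,
    orient (q (i, k + 3)) (q (i + 1, k + 3)) (q (i, k + 1)) <
      orient (q (i, k + 3)) (q (i + 1, k + 3)) (q (i, k)) ∧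
    orient (q (i, k + 3)) (q (i + 1, k + 3)) (q (i, k)) <
      orient (q (i, k + 3)) (q (i + 1, k + 3)) (q (i + 1, k))
  growth_right : ∀ i < m, ∀ k,
    orient (q (i, k + 2)) (q (i + 1, k + 2)) (q (i, k + 1)) <
      orient (q (i, k + 2)) (q (i + 1, k + 2)) (q (i, k)) ∧
    orient (q (i, k + 2)) (q (i + 1, k + 2)) (q (i + 1, k + 1)) <
      orient (q (i, k + 2)) (q (i + 1, k + 2)) (q (i, k + 1))
  cross : ∀ i < m, ∀ k, ∀ a : Fin 2, ∀ b : Fin 2,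
    0 < orient (q (i + a, k + 1)) (q (i + b, k + 3)) (q (i, k))
  circ : ∀ i < m, ∀ k, ∀ j ≤ m, ∀ l,
    (j ≠ i ∧ j ≠ i + 1) ∨ (l ≠ k ∧ l ≠ k + 1) →
      OutsideCircles (q (i, k)) (q (i + 1, k)) (q (i + 1, k + 1)) (q (i, k + 1)) (q (j, l))
  circ_zero : ∀ j ≤ m, 0 < j → ∀ l,
      OutsideCircles (q (0, 0)) (q (0, 1)) (q (0, 2)) (q (0, 3)) (q (j, l))

theorem fin_four_add (k : Fin 4) : k + 1 + 1 = k + 2 ∧ k + 1 + 2 = k + 3 ∧ k + 1 + 3 = k ∧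
    k + 2 + 1 = k + 3 ∧ k + 2 + 2 = k ∧ k + 2 + 3 = k + 1 ∧ k + 3 + 1 = k ∧ k + 3 + 2 = k + 1 ∧
      k + 3 + 3 = k + 2 := by
  revert k; decide

theorem fin_four_ne (k : Fin 4) : k ≠ k + 1 ∧ k ≠ k + 2 ∧ k ≠ k + 3 ∧ k + 1 ≠ k + 2 ∧
    k + 1 ≠ k + 3 ∧ k + 2 ≠ k + 3 := by
  revert k; decide

theorem fin_four_cases (k l : Fin 4) : l = k ∨ l = k + 1 ∨ l = k + 2 ∨ l = k + 3 := by
  revert k l; decide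

theorem convex_orient_nonneg (a b : Pt) : Convex ℝ {x | 0 ≤ orient a b x} := by
  intro x hx y hy p q hp hq hpq
  have h := orient_affine_combination a b (a := x) (b := y) (c := y) (α := p) (β := q) (γ := 0)
    (by linarith)
  rw [zero_smul, add_zero, zero_mul, add_zero] at h
  change 0 ≤ orient a b x at hx
  change 0 ≤ orient a b y at hy
  change 0 ≤ orient a b _
  rw [h]
  positivity

section

variable {m : ℕ} {q : ℕ × Fin 4 → Pt} {T : Set (Finset Pt)} {i : ℕ}

namespace IsRingConfig

theorem inner_nonneg (h : IsRingConfig m q) {i j : ℕ} (hi : i ≤ m) (hj : j ≤ i) (k l : Fin 4) :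
    0 ≤ orient (q (i, k)) (q (i, k + 1)) (q (j, l)) := by
  by_cases hc : j < i ∨ (l ≠ k ∧ l ≠ k + 1)
  · exact (h.inner i hi k j hj l hc).le
  · obtain rfl : j = i := by omega
    have : l = k ∨ l = k + 1 := by tauto
    rcases this with rfl | rfl
    · rw [orient_self_left]
    · rw [orient_self_right]

theorem mem_ringPoints {j : ℕ} (hj : j ≤ m) (l : Fin 4) : q (j, l) ∈ ringPoints m q :=
  ⟨(j, l), hj, rfl⟩

theorem isQuad (h : IsRingConfig m q) (hi : i < m) (k : Fin 4) :
    IsQuad (ringPoints m q) (q (i, k)) (q (i + 1, k)) (q (i + 1, k + 1)) (q (i, k + 1)) := by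
  refine ⟨⟨mem_ringPoints hi.le _, mem_ringPoints hi _, mem_ringPoints hi _,
    mem_ringPoints hi.le _⟩, (h.left i hi k).2, (h.left i hi k).1, ?_, ?_, ?_⟩
  · rw [orient_rotate]; exact (h.outer i hi k).2
  · exact h.inner (i + 1) hi k i (by omega) _ (Or.inl (by omega))
  · rintro _ ⟨⟨j, l⟩, hj, rfl⟩ h1 h2 h3 h4
    refine h.circ i hi k j hj l ?_
    by_contra! hc
    by_cases hl : l = k
    · subst hl
      by_cases hji : j = i
      · subst hji; exact h1 rfl
      · have := hc.1 hji; subst this; exact h2 rfl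
    · have := hc.2 hl
      subst this
      by_cases hji : j = i
      · subst hji; exact h4 rfl
      · have := hc.1 hji; subst this; exact h3 rfl

theorem isQuad_zero (h : IsRingConfig m q) :
    IsQuad (ringPoints m q) (q (0, 0)) (q (0, 1)) (q (0, 2)) (q (0, 3)) := by
  have hz := fun k l hkl => h.inner 0 (Nat.zero_le _) k 0 le_rfl l (Or.inr hkl)
  refine ⟨⟨mem_ringPoints (Nat.zero_le _) _, mem_ringPoints (Nat.zero_le _) _,
    mem_ringPoints (Nat.zero_le _) _, mem_ringPoints (Nat.zero_le _) _⟩,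
    hz 0 2 (by decide), hz 0 3 (by decide), ?_, hz 1 3 (by decide), ?_⟩
  · rw [← orient_rotate]; exact hz 2 0 (by decide)
  · rintro _ ⟨⟨j, l⟩, hj, rfl⟩ h1 h2 h3 h4
    refine h.circ_zero j hj (Nat.pos_of_ne_zero ?_) l
    rintro rfl
    fin_cases l
    exacts [h1 rfl, h2 rfl, h3 rfl, h4 rfl]

theorem exists_radial_edge (h : IsRingConfig m q) (hP : Generic (ringPoints m q))
    (hT : IsOrderDT (ringPoints m q) 1 T) (hi : i < m) (k : Fin 4) :
    ∃ t ∈ T, q (i, k) ∈ t ∧ q (i + 1, k) ∈ t := by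
  have h' := (h.isQuad hi (k + 3)).rotate.rotate
  rw [(fin_four_add k).2.2.2.2.2.2.1] at h'
  refine hT.exists_mem_of_isQuad hP (h.isQuad hi k) h' ?_
  rintro a b (rfl | rfl) (rfl | rfl) ⟨h1, -⟩
  · exact h1.not_gt (h.cross i hi k 1 0)
  · exact h1.not_gt (h.cross i hi k 1 1)
  · exact h1.not_gt (h.cross i hi k 0 0)
  · exact h1.not_gt (h.cross i hi k 0 1)

end IsRingConfig

theorem IsTriangulation.exists_left_triangle {P : Set Pt} (hT : IsTriangulation P T)
    (hP : Generic P) {u v c : Pt} (h : ∃ t ∈ T, u ∈ t ∧ v ∈ t) (hc : c ∈ P)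
    (hpos : 0 < orient u v c) : ∃ w, {u, v, w} ∈ T ∧ 0 < orient u v w := by
  obtain ⟨t, ht, hu, hv⟩ := h
  obtain ⟨d, rfl⟩ := exists_eq_triple (hT.2.1 t ht).1 hu hv (ne_of_orient_ne_zero hpos.ne').1
  rcases (hT.orient_ne hP ht).lt_or_gt with hd | hd
  · obtain ⟨w, hw, h⟩ := hT.exists_neighbor hP ht hc (mul_neg_of_pos_of_neg hpos hd)
    exact ⟨w, hw, (pos_iff_pos_of_mul_pos h).1 hpos⟩
  · exact ⟨d, ht, hd⟩

namespace IsRingConfig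

theorem exists_radial_triangles (h : IsRingConfig m q) (hP : Generic (ringPoints m q))
    (hT : IsOrderDT (ringPoints m q) 1 T) (hi : i < m) (k : Fin 4) :
    (∃ w, {q (i, k), q (i + 1, k), w} ∈ T ∧ 0 < orient (q (i, k)) (q (i + 1, k)) w) ∧
      ∃ w, {q (i + 1, k + 1), q (i, k + 1), w} ∈ T ∧
        0 < orient (q (i + 1, k + 1)) (q (i, k + 1)) w := by
  refine ⟨hT.1.exists_left_triangle hP (h.exists_radial_edge hP hT hi k)
    (mem_ringPoints hi.le (k + 1)) (h.left i hi k).1, ?_⟩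
  obtain ⟨t, ht, h1, h2⟩ := h.exists_radial_edge hP hT hi (k + 1)
  exact hT.1.exists_left_triangle hP ⟨t, ht, h2, h1⟩ (mem_ringPoints hi.le (k + 1 + 3))
    (h.right i hi (k + 1)).1

theorem exists_base_triangle (h : IsRingConfig m q) (hP : Generic (ringPoints m q))
    (hT : IsOrderDT (ringPoints m q) 1 T) (k : Fin 4) :
    ∃ w, {q (0, k), q (0, k + 1), w} ∈ T ∧ 0 < orient (q (0, k)) (q (0, k + 1)) w := by
  have hpos := h.inner 0 (Nat.zero_le _) k 0 le_rfl (k + 2)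
    (Or.inr ⟨(fin_four_ne k).2.1.symm, (fin_four_ne k).2.2.2.1.symm⟩)
  have hmem : ∀ l, q (0, l) ∈ ringPoints m q := mem_ringPoints (Nat.zero_le _)
  refine hT.1.exists_left_triangle hP ?_ (hmem (k + 2)) hpos
  rcases Nat.eq_zero_or_pos m with rfl | hm
  · refine (hT.1.edge_or_crossing hP (hmem _) (hmem _)
      (ne_of_orient_ne_zero hpos.ne').1).resolve_right ?_
    rintro ⟨a, b, ht, -, hb, -⟩
    obtain ⟨⟨j, l⟩, hj, rfl⟩ := (hT.1.triple ht).1.2.1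
    exact hb.not_ge (h.inner_nonneg le_rfl hj k l)
  · have ht := h.exists_radial_triangles hP hT hm k
    rcases (h.isQuad hm k).diagonalTriangles_subset hT ht.1 ht.2 with h' | h'
    · exact ⟨_, h' (Or.inr rfl), by simp, by simp⟩
    · exact ⟨_, h' (Or.inr rfl), by simp, by simp⟩

/-- The region between two consecutive rings is covered by four quadrilaterals. -/
theorem cover_step (h : IsRingConfig m q) (hi : i < m) (x : Pt) :
    (∀ k, 0 ≤ orient (q (i, k)) (q (i, k + 1)) x) ∨
      ∃ k, 0 ≤ orient (q (i, k)) (q (i + 1, k)) x ∧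
        0 ≤ orient (q (i + 1, k + 1)) (q (i, k + 1)) x ∧
          0 ≤ orient (q (i, k + 1)) (q (i, k)) x := by
  by_contra! hc
  obtain ⟨⟨k, hk⟩, hc⟩ := hc
  obtain ⟨a1, a2, a3, a4, a5, a6, a7, a8, a9⟩ := fin_four_add k
  have hmove : ∀ l, 0 ≤ orient (q (i, l)) (q (i + 1, l)) x →
      orient (q (i, l + 1)) (q (i + 1, l + 1)) x ≤ 0 → 0 < orient (q (i, l)) (q (i, l + 1)) x := by
    intro l h1 h2
    have := hc l h1 (by rw [orient_swap]; linarith)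
    rw [orient_swap] at this
    linarith
  have hN1 : orient (q (i, k)) (q (i, k + 1)) (q (i + 1, k)) < 0 := by
    rw [orient_swap]; linarith [(h.outer i hi k).1]
  have hN2 : 0 < orient (q (i, k + 1)) (q (i, k)) (q (i + 1, k + 1)) := (h.outer i hi k).2
  rcases lt_or_ge (orient (q (i, k)) (q (i + 1, k)) x) 0 with hr | hr
  · have e1 := orient_barycentric (q (i, k)) (q (i, k + 1)) (q (i + 1, k)) (q (i, k + 3))
      (q (i, k)) x
    have e2 := orient_barycentric (q (i, k)) (q (i, k + 1)) (q (i + 1, k)) (q (i, k + 3))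
      (q (i + 1, k + 3)) x
    have es := orient_add_orient_add_orient (q (i, k)) (q (i, k + 1)) (q (i + 1, k)) x
    have g1 := h.inner i hi.le (k + 3) i le_rfl (k + 1) (Or.inr ⟨(fin_four_ne k).2.2.2.2.1, by
      rw [a7]; exact (fin_four_ne k).1.symm⟩)
    have g2 := (h.outer i hi (k + 3)).2
    have g3 := (h.left i hi (k + 3)).1
    obtain ⟨g4, g5⟩ := h.growth_left i hi k
    have hm := hmove (k + 3)
    rw [a7] at g1 g2 g3 hm
    rw [orient_swap (q (i, k + 3))] at g2
    rw [orient_self_right, mul_zero, zero_add, orient_swap (q (i, k)) (q (i + 1, k)) x] at e1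
    rw [orient_swap (q (i, k)) (q (i + 1, k)) x] at e2 es
    have f1 : orient (q (i, k + 3)) (q (i, k)) x < 0 := by
      refine neg_of_mul_pos_right (a := orient (q (i, k)) (q (i, k + 1)) (q (i + 1, k))) ?_ hN1.le
      rw [e1]
      linarith [mul_pos (neg_pos.2 hr) g1, mul_pos (neg_pos.2 hk) g2]
    refine f1.not_gt (hm ?_ hr.le)
    refine (pos_of_mul_neg_right (a := orient (q (i, k)) (q (i, k + 1)) (q (i + 1, k)))
      ?_ hN1.le).le
    rw [e2, eq_sub_of_add_eq (eq_sub_of_add_eq es)]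
    linarith [mul_neg_of_neg_of_pos hN1 g3, mul_neg_of_neg_of_pos hr (sub_pos.2 g4),
      mul_neg_of_neg_of_pos hk (sub_pos.2 g5)]
  rcases lt_or_ge 0 (orient (q (i, k + 1)) (q (i + 1, k + 1)) x) with hr' | hr'
  · have e1 := orient_barycentric (q (i, k + 1)) (q (i, k)) (q (i + 1, k + 1)) (q (i, k + 1))
      (q (i, k + 2)) x
    have e2 := orient_barycentric (q (i, k + 1)) (q (i, k)) (q (i + 1, k + 1)) (q (i, k + 2))
      (q (i + 1, k + 2)) x
    have es := orient_add_orient_add_orient (q (i, k + 1)) (q (i, k)) (q (i + 1, k + 1)) x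
    have g1 := h.inner i hi.le (k + 1) i le_rfl k (Or.inr ⟨(fin_four_ne k).1, by
      rw [a1]; exact (fin_four_ne k).2.1⟩)
    have g2 := (h.outer i hi (k + 1)).1
    have g3 := (h.right i hi (k + 2)).1
    obtain ⟨g4, g5⟩ := h.growth_right i hi k
    have hm := hmove (k + 1)
    rw [a1] at g1 g2 hm
    rw [a6, orient_swap (q (i, k + 2))] at g3
    rw [orient_swap (q (i, k + 1))] at g2
    rw [orient_self_left, mul_zero, zero_add, orient_swap (q (i, k)) (q (i, k + 1)) x,
      orient_swap (q (i, k + 1)) (q (i + 1, k + 1)) x] at e1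
    rw [orient_swap (q (i, k)) (q (i, k + 1)) x,
      orient_swap (q (i, k + 1)) (q (i + 1, k + 1)) x] at e2 es
    have f1 : orient (q (i, k + 1)) (q (i, k + 2)) x < 0 := by
      refine neg_of_mul_neg_right (a := orient (q (i, k + 1)) (q (i, k)) (q (i + 1, k + 1)))
        ?_ hN2.le
      rw [e1]
      linarith [mul_pos hr' g1, mul_pos (neg_pos.2 hk) g2]
    refine f1.not_gt (hm hr'.le ?_)
    refine (neg_of_mul_neg_right (a := orient (q (i, k + 1)) (q (i, k)) (q (i + 1, k + 1)))
      ?_ hN2.le).le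
    rw [e2, eq_sub_of_add_eq (eq_sub_of_add_eq es)]
    linarith [mul_pos hN2 g3, mul_pos hr' (sub_pos.2 g4), mul_neg_of_neg_of_pos hk (sub_pos.2 g5)]
  · exact hk.not_gt (hmove k hr hr')

theorem cover (h : IsRingConfig m q) {x : Pt} (hi : i ≤ m)
    (hx : ∀ k, 0 ≤ orient (q (i, k)) (q (i, k + 1)) x) :
    (∀ k, 0 ≤ orient (q (0, k)) (q (0, k + 1)) x) ∨ ∃ j < i, ∃ k,
      0 ≤ orient (q (j, k)) (q (j + 1, k)) x ∧ 0 ≤ orient (q (j + 1, k)) (q (j + 1, k + 1)) x ∧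
        0 ≤ orient (q (j + 1, k + 1)) (q (j, k + 1)) x ∧
          0 ≤ orient (q (j, k + 1)) (q (j, k)) x := by
  induction i with
  | zero => exact Or.inl hx
  | succ i ih =>
    rcases h.cover_step hi x with hx' | ⟨k, h1, h2, h3⟩
    · refine (ih (by omega) hx').imp_right ?_
      rintro ⟨j, hj, hk⟩
      exact ⟨j, by omega, hk⟩
    · exact Or.inr ⟨i, by omega, k, h1, hx k, h2, h3⟩

theorem outer_nonpos (h : IsRingConfig m q) (hi : i < m) (k : Fin 4) {x : Pt}
    (hx : x ∈ ({q (i, k), q (i + 1, k), q (i + 1, k + 1), q (i, k + 1)} : Finset Pt)) :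
    orient (q (i, k)) (q (i, k + 1)) x ≤ 0 := by
  simp only [Finset.mem_insert, Finset.mem_singleton] at hx
  have := h.outer i hi k
  rcases hx with rfl | rfl | rfl | rfl
  · rw [orient_self_left]
  · rw [orient_swap]; linarith
  · rw [orient_swap]; linarith
  · rw [orient_self_right]

theorem separated_of_inner (h : IsRingConfig m q) {s : Finset Pt} (hi : i < m) (k : Fin 4)
    (hs : ∀ x ∈ s, 0 ≤ orient (q (i, k)) (q (i, k + 1)) x) :
    SeparatedByLine s {q (i, k), q (i + 1, k), q (i + 1, k + 1), q (i, k + 1)} :=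
  ⟨_, _, (ne_of_orient_ne_zero (h.opposite i hi k).1.ne').1, hs,
    fun _ hx => h.outer_nonpos hi k hx⟩

theorem separated_of_lt (h : IsRingConfig m q) {j : ℕ} (hij : i < j) (hj : j < m) (k l : Fin 4) :
    SeparatedByLine {q (i, k), q (i + 1, k), q (i + 1, k + 1), q (i, k + 1)}
      {q (j, l), q (j + 1, l), q (j + 1, l + 1), q (j, l + 1)} := by
  refine h.separated_of_inner hj l fun x hx => ?_
  simp only [Finset.mem_insert, Finset.mem_singleton] at hx
  rcases hx with rfl | rfl | rfl | rfl
  · exact h.inner_nonneg hj.le hij.le l k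
  · exact h.inner_nonneg hj.le hij l k
  · exact h.inner_nonneg hj.le hij l (k + 1)
  · exact h.inner_nonneg hj.le hij.le l (k + 1)

theorem separated_succ (h : IsRingConfig m q) (hi : i < m) (k : Fin 4) :
    SeparatedByLine
      {q (i, k + 1), q (i + 1, k + 1), q (i + 1, k + 1 + 1), q (i, k + 1 + 1)}
      {q (i, k), q (i + 1, k), q (i + 1, k + 1), q (i, k + 1)} := by
  have hl := h.left i hi (k + 1)
  have hr := h.right i hi (k + 1)
  rw [(fin_four_add k).2.2.1] at hr
  refine ⟨q (i, k + 1), q (i + 1, k + 1), (ne_of_orient_ne_zero hl.1.ne').1, fun x hx => ?_,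
    fun x hx => ?_⟩ <;> simp only [Finset.mem_insert, Finset.mem_singleton] at hx <;>
    rcases hx with rfl | rfl | rfl | rfl
  · rw [orient_self_left]
  · rw [orient_self_right]
  · exact hl.2.le
  · exact hl.1.le
  · rw [orient_swap]; linarith
  · rw [orient_swap]; linarith
  · rw [orient_self_right]
  · rw [orient_self_left]

theorem separated (h : IsRingConfig m q) (hi : i < m) {k l : Fin 4} (hne : k ≠ l) :
    SeparatedByLine {q (i, k), q (i + 1, k), q (i + 1, k + 1), q (i, k + 1)}
      {q (i, l), q (i + 1, l), q (i + 1, l + 1), q (i, l + 1)} := by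
  rcases fin_four_cases k l with rfl | rfl | rfl | rfl
  · exact absurd rfl hne
  · exact (h.separated_succ hi k).symm
  · refine (h.separated_of_inner hi k fun x hx => ?_).symm
    rw [(fin_four_add k).2.2.2.1] at hx
    simp only [Finset.mem_insert, Finset.mem_singleton] at hx
    rcases hx with rfl | rfl | rfl | rfl
    · exact h.inner_nonneg hi.le le_rfl k _
    · exact (h.opposite i hi k).1.le
    · exact (h.opposite i hi k).2.le
    · exact h.inner_nonneg hi.le le_rfl k _
  · have := h.separated_succ hi (k + 3)
    rwa [(fin_four_add k).2.2.2.2.2.2.1] at this ⊢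

/-- The quadrilaterals of a ring configuration. -/
theorem isQuadrangulation (h : IsRingConfig m q) :
    IsQuadrangulation (κ := Option (Fin m × Fin 4)) (ringPoints m q)
      (fun x => x.elim (q (0, 0)) fun y => q (y.1, y.2))
      (fun x => x.elim (q (0, 1)) fun y => q (y.1 + 1, y.2))
      (fun x => x.elim (q (0, 2)) fun y => q (y.1 + 1, y.2 + 1))
      (fun x => x.elim (q (0, 3)) fun y => q (y.1, y.2 + 1)) := by
  have hzero : ∀ (i : ℕ) (k : Fin 4), i < m →
      SeparatedByLine {q (0, 0), q (0, 1), q (0, 2), q (0, 3)}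
        {q (i, k), q (i + 1, k), q (i + 1, k + 1), q (i, k + 1)} := by
    intro i k hi
    refine h.separated_of_inner hi k fun x hx => ?_
    simp only [Finset.mem_insert, Finset.mem_singleton] at hx
    rcases hx with rfl | rfl | rfl | rfl <;> exact h.inner_nonneg hi.le (Nat.zero_le _) k _
  constructor
  · rintro (_ | ⟨i, k⟩)
    · exact h.isQuad_zero
    · exact h.isQuad i.2 k
  · rintro (_ | ⟨i, k⟩) (_ | ⟨j, l⟩) hne
    · exact absurd rfl hne
    · exact hzero j l j.2
    · exact (hzero i k i.2).symm
    · rcases lt_trichotomy i j with hij | rfl | hij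
      · exact h.separated_of_lt hij j.2 k l
      · exact h.separated i.2 (by rintro rfl; exact hne rfl)
      · exact (h.separated_of_lt hij i.2 l k).symm
  · intro x hx
    have hx' : ∀ k, 0 ≤ orient (q (m, k)) (q (m, k + 1)) x := by
      intro k
      refine convexHull_min ?_ (convex_orient_nonneg (q (m, k)) (q (m, k + 1))) hx
      rintro _ ⟨⟨j, l⟩, hj, rfl⟩
      exact h.inner_nonneg le_rfl hj k l
    rcases h.cover le_rfl hx' with h0 | ⟨j, hj, k, hk⟩
    · exact ⟨none, h0 0, h0 1, h0 2, h0 3⟩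
    · exact ⟨some (⟨j, hj⟩, k), hk⟩
  · rintro _ ⟨⟨j, l⟩, hj, rfl⟩
    rcases j with _ | i
    · refine ⟨none, ?_⟩
      fin_cases l <;> simp
    · exact ⟨some (⟨i, hj⟩, l), by simp⟩

theorem ncard_isOrderDT (h : IsRingConfig m q) (hP : Generic (ringPoints m q)) :
    {T : Set (Finset Pt) | IsOrderDT (ringPoints m q) 1 T}.ncard = 2 ^ (4 * m + 1) := by
  rw [h.isQuadrangulation.ncard_isOrderDT hP]
  · simp [mul_comm]
  · rintro T hT (_ | ⟨i, k⟩)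
    · exact ⟨h.exists_base_triangle hP hT 0, h.exists_base_triangle hP hT 2⟩
    · exact h.exists_radial_triangles hP hT i.2 k

end IsRingConfig

end

/-! ### Existence of generic ring configurations -/

/-- Concentric squares whose sizes double from one ring to the next. -/
def squareRings (x : ℕ × Fin 4) : Pt :=
  !₂[2 ^ x.1 * (![1, 0, -1, 0] : Fin 4 → ℝ) x.2, 2 ^ x.1 * (![0, 1, 0, -1] : Fin 4 → ℝ) x.2]

theorem squareRings_circ {i j : ℕ} {k l : Fin 4}
    (h : (j ≠ i ∧ j ≠ i + 1) ∨ (l ≠ k ∧ l ≠ k + 1)) :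
    OutsideCircles (squareRings (i, k)) (squareRings (i + 1, k)) (squareRings (i + 1, k + 1))
      (squareRings (i, k + 1)) (squareRings (j, l)) := by
  have hR : (0 : ℝ) < 2 ^ i := by positivity
  have hS : (0 : ℝ) < 2 ^ j := by positivity
  have hsum : (0 : ℝ) < 2 ^ i * 2 ^ i * ((2 ^ j + 2 ^ i) * (2 ^ j + 2 * 2 ^ i)) := by positivity
  have hdiff : (l = k ∨ l = k + 1) →
      (0 : ℝ) < 2 ^ i * 2 ^ i * ((2 ^ j - 2 ^ i) * (2 ^ j - 2 * 2 ^ i)) := by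
    intro hl
    have hj : j < i ∨ i + 1 < j := by
      rcases h with h | h
      · omega
      · tauto
    refine mul_pos (by positivity) ?_
    rcases hj with hj | hj
    · have : (2 : ℝ) ^ j < 2 ^ i := pow_lt_pow_right₀ (by norm_num) hj
      exact mul_pos_of_neg_of_neg (by linarith) (by linarith)
    · have : (2 : ℝ) ^ (i + 1) < 2 ^ j := pow_lt_pow_right₀ (by norm_num) hj
      rw [pow_succ] at this
      exact mul_pos (by linarith) (by linarith)
  clear h
  simp only [OutsideCircles, circleDet, orient, squareRings, pow_succ]
  generalize (2 : ℝ) ^ i = R at *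
  generalize (2 : ℝ) ^ j = S at *
  fin_cases k <;> fin_cases l <;> simp at hdiff ⊢ <;> refine ⟨?_, ?_, ?_, ?_⟩ <;> linarith

theorem isRingConfig_squareRings (m : ℕ) : IsRingConfig m squareRings where
  inner i _ k j hj l h := by
    have hR : (0 : ℝ) < 2 ^ i := by positivity
    have hS : (0 : ℝ) < 2 ^ j := by positivity
    have hle : (2 : ℝ) ^ j ≤ 2 ^ i := pow_le_pow_right₀ (by norm_num) hj
    have hlt : (l = k ∨ l = k + 1) → (2 : ℝ) ^ j < 2 ^ i := fun hl =>
      pow_lt_pow_right₀ (by norm_num) (by tauto)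
    clear h
    simp only [orient, squareRings]
    generalize (2 : ℝ) ^ i = R at *
    generalize (2 : ℝ) ^ j = S at *
    fin_cases k <;> fin_cases l <;> simp at hlt ⊢ <;> nlinarith
  outer i _ k := by
    have hR : (0 : ℝ) < 2 ^ i * 2 ^ i := by positivity
    simp only [orient, squareRings, pow_succ]
    fin_cases k <;> simp <;> linarith
  opposite i _ k := by
    have hR₁ : (0 : ℝ) < 2 ^ i := by positivity
    have hR : (0 : ℝ) < 2 ^ i * 2 ^ i := by positivity
    simp only [orient, squareRings, pow_succ]
    fin_cases k <;> simp <;> constructor <;> linarith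
  left i _ k := by
    have hR : (0 : ℝ) < 2 ^ i * 2 ^ i := by positivity
    simp only [orient, squareRings, pow_succ]
    fin_cases k <;> simp <;> constructor <;> linarith
  right i _ k := by
    have hR : (0 : ℝ) < 2 ^ i * 2 ^ i := by positivity
    simp only [orient, squareRings, pow_succ]
    fin_cases k <;> simp <;> constructor <;> linarith
  growth_left i _ k := by
    have hR : (0 : ℝ) < 2 ^ i * 2 ^ i := by positivity
    simp only [orient, squareRings, pow_succ]
    fin_cases k <;> simp <;> constructor <;> linarith
  growth_right i _ k := by
    have hR : (0 : ℝ) < 2 ^ i * 2 ^ i := by positivity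
    simp only [orient, squareRings, pow_succ]
    fin_cases k <;> simp <;> constructor <;> linarith
  cross i _ k a b := by
    have hR₁ : (0 : ℝ) < 2 ^ i := by positivity
    have hR : (0 : ℝ) < 2 ^ i * 2 ^ i := by positivity
    simp only [orient, squareRings, pow_add]
    fin_cases k <;> fin_cases a <;> fin_cases b <;> simp <;> linarith
  circ i _ k j _ l h := squareRings_circ h
  circ_zero j _ hj l := by
    have hS : (1 : ℝ) < 2 ^ j := one_lt_pow₀ (by norm_num) hj.ne'
    have hS' : (1 : ℝ) < 2 ^ j * 2 ^ j := by nlinarith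
    simp only [OutsideCircles, circleDet, orient, squareRings]
    fin_cases l <;> simp <;> refine ⟨?_, ?_, ?_, ?_⟩ <;> linarith

theorem eventually_orient_lt_orient {ι : Type*} {q₀ : ι → Pt} {a b c d e f : ι}
    (h : orient (q₀ a) (q₀ b) (q₀ c) < orient (q₀ d) (q₀ e) (q₀ f)) :
    ∀ᶠ q in nhds q₀, orient (q a) (q b) (q c) < orient (q d) (q e) (q f) := by
  refine Filter.Tendsto.eventually_lt (Continuous.tendsto ?_ _) (Continuous.tendsto ?_ _) h <;>
  · unfold orient
    fun_prop

theorem eventually_orient_pos {ι : Type*} {q₀ : ι → Pt} {a b c : ι}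
    (h : 0 < orient (q₀ a) (q₀ b) (q₀ c)) :
    ∀ᶠ q in nhds q₀, 0 < orient (q a) (q b) (q c) := by
  refine Filter.Tendsto.eventually_lt tendsto_const_nhds (Continuous.tendsto ?_ _) h
  unfold orient
  fun_prop

theorem eventually_outsideCircles {ι : Type*} {q₀ : ι → Pt} {a b c d e : ι}
    (h : OutsideCircles (q₀ a) (q₀ b) (q₀ c) (q₀ d) (q₀ e)) :
    ∀ᶠ q in nhds q₀, OutsideCircles (q a) (q b) (q c) (q d) (q e) := by
  have key (x y z w : ι) (h : 0 < circleDet (q₀ x) (q₀ y) (q₀ z) (q₀ w)) :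
      ∀ᶠ q in nhds q₀, 0 < circleDet (q x) (q y) (q z) (q w) := by
    refine Filter.Tendsto.eventually_lt tendsto_const_nhds (Continuous.tendsto ?_ _) h
    unfold circleDet orient
    fun_prop
  obtain ⟨h₁, h₂, h₃, h₄⟩ := h
  exact (key _ _ _ _ h₁).and ((key _ _ _ _ h₂).and ((key _ _ _ _ h₃).and (key _ _ _ _ h₄)))

theorem IsRingConfig.eventually {m : ℕ} {q₀ : ℕ × Fin 4 → Pt} (h : IsRingConfig m q₀) :
    ∀ᶠ q in nhds q₀, IsRingConfig m q := by
  have lt {p : ℕ → Fin 4 → (ℕ × Fin 4 → Pt) → Prop}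
      (hp : ∀ i < m, ∀ k, ∀ᶠ q in nhds q₀, p i k q) :
      ∀ᶠ q in nhds q₀, ∀ i < m, ∀ k, p i k q :=
    (Filter.eventually_all_finite (finite_Iio m)).2 fun i hi =>
      Filter.eventually_all.2 fun k => hp i hi k
  have le {n : ℕ} {p : ℕ → (ℕ × Fin 4 → Pt) → Prop} (hp : ∀ j ≤ n, ∀ᶠ q in nhds q₀, p j q) :
      ∀ᶠ q in nhds q₀, ∀ j ≤ n, p j q :=
    (Filter.eventually_all_finite (finite_Iic n)).2 hp
  have inner := le fun i hi => Filter.eventually_all.2 fun k => le fun j hj =>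
    Filter.eventually_all.2 fun l => Filter.eventually_imp_distrib_left.2 fun hl =>
      eventually_orient_pos (h.inner i hi k j hj l hl)
  have outer := lt fun i hi k =>
    (eventually_orient_pos (h.outer i hi k).1).and (eventually_orient_pos (h.outer i hi k).2)
  have opposite := lt fun i hi k =>
    (eventually_orient_pos (h.opposite i hi k).1).and (eventually_orient_pos (h.opposite i hi k).2)
  have left := lt fun i hi k =>
    (eventually_orient_pos (h.left i hi k).1).and (eventually_orient_pos (h.left i hi k).2)
  have right := lt fun i hi k =>
    (eventually_orient_pos (h.right i hi k).1).and (eventually_orient_pos (h.right i hi k).2)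
  have growth_left := lt fun i hi k =>
    (eventually_orient_lt_orient (h.growth_left i hi k).1).and
      (eventually_orient_lt_orient (h.growth_left i hi k).2)
  have growth_right := lt fun i hi k =>
    (eventually_orient_lt_orient (h.growth_right i hi k).1).and
      (eventually_orient_lt_orient (h.growth_right i hi k).2)
  have cross := lt fun i hi k => Filter.eventually_all.2 fun a => Filter.eventually_all.2 fun b =>
    eventually_orient_pos (h.cross i hi k a b)
  have circ := lt fun i hi k => le fun j hj => Filter.eventually_all.2 fun l =>
    Filter.eventually_imp_distrib_left.2 fun hl =>
      eventually_outsideCircles (h.circ i hi k j hj l hl)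
  have circ_zero := le fun j hj => Filter.eventually_imp_distrib_left.2 fun hj₀ =>
    Filter.eventually_all.2 fun l => eventually_outsideCircles (h.circ_zero j hj hj₀ l)
  filter_upwards [inner, outer, opposite, left, right, growth_left, growth_right, cross, circ,
    circ_zero] with q h₁ h₂ h₃ h₄ h₅ h₆ h₇ h₈ h₉ h₁₀
  exact ⟨h₁, h₂, h₃, h₄, h₅, h₆, h₇, h₈, h₉, h₁₀⟩

theorem dense_setOf_ne_zero {E : Type*} [AddCommGroup E] [Module ℝ E] [TopologicalSpace E]
    [ContinuousAdd E] [ContinuousSMul ℝ E] {F : E → ℝ}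
    (hF : ∀ p v, AnalyticOnNhd ℝ (fun t : ℝ => F (p + t • v)) univ) {w : E} (hw : F w ≠ 0) :
    Dense {p | F p ≠ 0} := by
  intro p
  have hfreq : ∃ᶠ t : ℝ in nhdsWithin 0 {0}ᶜ, F (p + t • (w - p)) ≠ 0 := by
    by_contra hzero
    simp only [Filter.not_frequently, not_not] at hzero
    have h := (hF p (w - p)).eqOn_zero_of_preconnected_of_frequently_eq_zero isPreconnected_univ
      (mem_univ 0) hzero.frequently (mem_univ 1)
    exact hw (by simpa using h)
  have hlim : Filter.Tendsto (fun t : ℝ => p + t • (w - p)) (nhdsWithin 0 {0}ᶜ) (nhds p) := by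
    have : Continuous fun t : ℝ => p + t • (w - p) := by fun_prop
    exact tendsto_nhdsWithin_of_tendsto_nhds (by simpa using this.tendsto 0)
  exact mem_closure_iff_frequently.2 (hlim.frequently hfreq)

theorem dense_orient_ne_zero {ι : Type*} {a b c : ι} (hab : a ≠ b) (hac : a ≠ c) (hbc : b ≠ c) :
    Dense {q : ι → Pt | orient (q a) (q b) (q c) ≠ 0} := by
  classical
  refine dense_setOf_ne_zero (fun p v => ?_)
    (w := fun x => if x = a then !₂[0, 0] else if x = b then !₂[1, 0] else !₂[0, 1]) ?_
  · intro t _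
    simp only [orient, Pi.add_apply, Pi.smul_apply, PiLp.add_apply, PiLp.smul_apply, smul_eq_mul]
    fun_prop
  · simp [orient, hab.symm, hac.symm, hbc.symm]

theorem dense_circleDet_ne_zero {ι : Type*} {a b c d : ι} (hab : a ≠ b) (hac : a ≠ c)
    (had : a ≠ d) (hbc : b ≠ c) (hbd : b ≠ d) (hcd : c ≠ d) :
    Dense {q : ι → Pt | circleDet (q a) (q b) (q c) (q d) ≠ 0} := by
  classical
  refine dense_setOf_ne_zero (fun p v => ?_)
    (w := fun x => if x = a then !₂[0, 0] else if x = b then !₂[1, 0] else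
      if x = c then !₂[0, 1] else !₂[2, 2]) ?_
  · intro t _
    simp only [circleDet, orient, Pi.add_apply, Pi.smul_apply, PiLp.add_apply, PiLp.smul_apply,
      smul_eq_mul]
    fun_prop
  · simp [circleDet, orient, hab.symm, hac.symm, hbc.symm, had.symm, hbd.symm, hcd.symm]
    norm_num

theorem isOpen_orient_ne_zero {ι : Type*} (a b c : ι) :
    IsOpen {q : ι → Pt | orient (q a) (q b) (q c) ≠ 0} := by
  refine isOpen_ne_fun ?_ continuous_const
  unfold orient
  fun_prop

theorem isOpen_circleDet_ne_zero {ι : Type*} (a b c d : ι) :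
    IsOpen {q : ι → Pt | circleDet (q a) (q b) (q c) (q d) ≠ 0} := by
  refine isOpen_ne_fun ?_ continuous_const
  unfold circleDet orient
  fun_prop

/-- Generic position for an indexed family of points. -/
def GenericFamily {ι : Type*} (q : ι → Pt) : Prop :=
  (∀ a b c, a ≠ b → a ≠ c → b ≠ c → orient (q a) (q b) (q c) ≠ 0) ∧
  ∀ a b c d, a ≠ b → a ≠ c → a ≠ d → b ≠ c → b ≠ d → c ≠ d →
    circleDet (q a) (q b) (q c) (q d) ≠ 0

theorem dense_genericFamily {ι : Type*} [Countable ι] :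
    Dense {q : ι → Pt | GenericFamily q} := by
  have h₁ : Dense (⋂ x ∈ {x : ι × ι × ι | x.1 ≠ x.2.1 ∧ x.1 ≠ x.2.2 ∧ x.2.1 ≠ x.2.2},
      {q : ι → Pt | orient (q x.1) (q x.2.1) (q x.2.2) ≠ 0}) :=
    dense_biInter_of_isOpen (fun _ _ => isOpen_orient_ne_zero _ _ _) (to_countable _)
      fun _ hx => dense_orient_ne_zero hx.1 hx.2.1 hx.2.2
  have h₂ : Dense (⋂ x ∈ {x : ι × ι × ι × ι | x.1 ≠ x.2.1 ∧ x.1 ≠ x.2.2.1 ∧ x.1 ≠ x.2.2.2 ∧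
      x.2.1 ≠ x.2.2.1 ∧ x.2.1 ≠ x.2.2.2 ∧ x.2.2.1 ≠ x.2.2.2},
      {q : ι → Pt | circleDet (q x.1) (q x.2.1) (q x.2.2.1) (q x.2.2.2) ≠ 0}) :=
    dense_biInter_of_isOpen (fun _ _ => isOpen_circleDet_ne_zero _ _ _ _) (to_countable _)
      fun _ hx => dense_circleDet_ne_zero hx.1 hx.2.1 hx.2.2.1 hx.2.2.2.1 hx.2.2.2.2.1 hx.2.2.2.2.2
  have h := h₁.inter_of_Gδ (.biInter (to_countable _) fun _ _ =>
    (isOpen_orient_ne_zero _ _ _).isGδ) (.biInter (to_countable _) fun _ _ =>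
      (isOpen_circleDet_ne_zero _ _ _ _).isGδ) h₂
  refine h.mono ?_
  rintro q ⟨hq₁, hq₂⟩
  simp only [mem_iInter] at hq₁ hq₂
  exact ⟨fun a b c hab hac hbc => hq₁ (a, b, c) ⟨hab, hac, hbc⟩,
    fun a b c d hab hac had hbc hbd hcd =>
      hq₂ (a, b, c, d) ⟨hab, hac, had, hbc, hbd, hcd⟩⟩

theorem GenericFamily.injective {ι : Type*} [Infinite ι] {q : ι → Pt} (h : GenericFamily q) :
    Function.Injective q := by
  classical
  intro a b hab
  by_contra hne
  obtain ⟨c, hc⟩ := Infinite.exists_notMem_finset ({a, b} : Finset ι)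
  simp only [Finset.mem_insert, Finset.mem_singleton, not_or] at hc
  exact (ne_of_orient_ne_zero (h.1 a b c hne (Ne.symm hc.1) (Ne.symm hc.2))).1 hab

theorem GenericFamily.generic_image {ι : Type*} {q : ι → Pt} (h : GenericFamily q) (s : Set ι) :
    Generic (q '' s) where
  orient_ne := by
    rintro _ _ _ ⟨a, _, rfl⟩ ⟨b, _, rfl⟩ ⟨c, _, rfl⟩ hab hac hbc
    exact h.1 a b c (ne_of_apply_ne q hab) (ne_of_apply_ne q hac) (ne_of_apply_ne q hbc)
  circleDet_ne := by
    rintro _ _ _ _ ⟨a, _, rfl⟩ ⟨b, _, rfl⟩ ⟨c, _, rfl⟩ ⟨d, _, rfl⟩ hab hac had hbc hbd hcd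
    exact h.2 a b c d (ne_of_apply_ne q hab) (ne_of_apply_ne q hac) (ne_of_apply_ne q had)
      (ne_of_apply_ne q hbc) (ne_of_apply_ne q hbd) (ne_of_apply_ne q hcd)

theorem setOf_fst_le_eq (m : ℕ) :
    {x : ℕ × Fin 4 | x.1 ≤ m} = ((Finset.range (m + 1) ×ˢ Finset.univ : Finset (ℕ × Fin 4)) :
      Set (ℕ × Fin 4)) := by
  ext x
  simp

/-- Lemma 3.2 (tightness): for every multiple of 4, `n ≥ 4`, there exists a set of `n`
points in general position having exactly `2 ^ (n - 3)` order-1 Delaunay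
triangulations. -/
theorem exists_point_set_with_max_order_one_triangulations
    (n : ℕ) (hn : 4 ≤ n) (hdvd : 4 ∣ n) :
    ∃ P : Set Pt, P.Finite ∧ P.ncard = n ∧ GenPos P ∧
      {T : Set (Finset Pt) | IsOrderDT P 1 T}.ncard = 2 ^ (n - 3) := by
  obtain ⟨m, rfl⟩ : ∃ m, n = 4 * (m + 1) := by
    obtain ⟨k, rfl⟩ := hdvd
    exact ⟨k - 1, by omega⟩
  obtain ⟨q, hgen, hq⟩ :=
    dense_genericFamily.inter_nhds_nonempty (isRingConfig_squareRings m).eventually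
  have hP : Generic (ringPoints m q) := hgen.generic_image _
  refine ⟨ringPoints m q, ?_, ?_, hP.genPos, ?_⟩
  · rw [ringPoints, setOf_fst_le_eq]
    exact (Finset.finite_toSet _).image q
  · rw [ringPoints, ncard_image_of_injective _ hgen.injective, setOf_fst_le_eq, ncard_coe_finset,
      Finset.card_product, Finset.card_range, Finset.card_univ, Fintype.card_fin, mul_comm]
  · rw [hq.ncard_isOrderDT hP]
    congr 1

end
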